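/- arXiv:2109.00487 — 2 statements merged into one kernel-verified Lean document; each statement's English description precedes it below -/
import Mathlib

section
/- (Marginal rates of substitution.) In the multiplicatively separable monopoly pricing model, suppose the seller's cost function C is continuous, nondecreasing, and does not depend on the buyer's type (with C(0) = 0), and suppose the vector of marginal rates of substitution r^B = (θ^1/θ^A, …, θ^N/θ^A) is stochastically nondecreasing in θ^A. Then there exists a mechanism that involves no costly screening (y ≡ y₀ and (x, t) depending only on θ^A) and attains the supremum of the seller's expected payoff over all IC and IR measurable mechanisms. -/
open MeasureTheory Set ProbabilityTheory

noncomputable section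

/-- `κ` is a regular conditional distribution of the second coordinate given the
first coordinate, under the joint law `ρ`. -/
def IsRCD {A B : Type*} [MeasurableSpace A] [MeasurableSpace B]
    (ρ : Measure (A × B)) (κ : Kernel A B) : Prop :=
  IsMarkovKernel κ ∧
    ∀ s : Set (A × B), MeasurableSet s →
      ρ s = ∫⁻ a, κ a {b | (a, b) ∈ s} ∂ρ.fst

/-- The topological support of a measure on `ℝ`. -/
def MSupport (μ : Measure ℝ) : Set ℝ :=
  {a | ∀ U : Set ℝ, IsOpen U → a ∈ U → 0 < μ U}

variable {N : ℕ} {Y : Type} [MeasurableSpace Y]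

/-- A measurable IC and IR mechanism in the multiplicatively separable monopoly
pricing model: buyer payoff `θ^A u(x) + θ^B ⬝ c(y) − t`. -/
def MechanismMS (ΘA : Set ℝ) (ΘB : Set (Fin N → ℝ))
    (u : ℝ → ℝ) (c : Y → (Fin N → ℝ))
    (γ : Measure (ℝ × (Fin N → ℝ)))
    (x : ℝ × (Fin N → ℝ) → ℝ) (y : ℝ × (Fin N → ℝ) → Y)
    (t : ℝ × (Fin N → ℝ) → ℝ) : Prop :=
  Measurable x ∧ Measurable y ∧ Measurable t ∧ Integrable t γ ∧
    (∀ θ ∈ ΘA ×ˢ ΘB, x θ ∈ Icc (0 : ℝ) 1) ∧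
    (∀ θ ∈ ΘA ×ˢ ΘB, ∀ θ' ∈ ΘA ×ˢ ΘB,
      θ.1 * u (x θ) + (∑ i, θ.2 i * c (y θ) i) - t θ ≥
        θ.1 * u (x θ') + (∑ i, θ.2 i * c (y θ') i) - t θ') ∧
    (∀ θ ∈ ΘA ×ˢ ΘB, θ.1 * u (x θ) + (∑ i, θ.2 i * c (y θ) i) - t θ ≥ 0)

/-- The seller's expected payoff. -/
def SellerPayoff (C : ℝ → ℝ) (γ : Measure (ℝ × (Fin N → ℝ)))
    (x t : ℝ × (Fin N → ℝ) → ℝ) : ℝ :=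
  ∫ θ, (-C (x θ) + t θ) ∂γ

/-- A monotone selection of subgradients integrates to the increment of the function. -/
lemma integral_Ioc_subgradient {f g : ℝ → ℝ} {q : ℝ} (hq : 0 ≤ q) (hg : Monotone g)
    (h : ∀ x ∈ Icc 0 q, ∀ y ∈ Icc 0 q, f x + g x * (y - x) ≤ f y) :
    ∫ z in Ioc 0 q, g z = f q - f 0 := by
  rw [← intervalIntegral.integral_of_le hq]
  have hint : ∀ a b, IntervalIntegrable g volume a b := fun a b => hg.intervalIntegrable
  set F : ℝ → ℝ := fun y => f y - ∫ z in (0 : ℝ)..y, g z with hF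
  have key : ∀ x ∈ Icc 0 q, ∀ y ∈ Icc 0 q, x ≤ y →
      |F y - F x| ≤ (g y - g x) * (y - x) := by
    intro x hx y hy hxy
    have h1 : F y - F x = (f y - f x) - ∫ z in x..y, g z := by
      have := intervalIntegral.integral_add_adjacent_intervals (hint 0 x) (hint x y)
      simp only [hF]; linarith
    have h2 : g x * (y - x) ≤ ∫ z in x..y, g z := by
      have := intervalIntegral.integral_mono_on hxy (intervalIntegrable_const (c := g x))
        (hint x y) (fun z hz => hg hz.1)
      simpa [mul_comm] using this
    have h3 : ∫ z in x..y, g z ≤ g y * (y - x) := by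
      have := intervalIntegral.integral_mono_on hxy (hint x y)
        (intervalIntegrable_const (c := g y)) (fun z hz => hg hz.2)
      simpa [mul_comm] using this
    have h4 := h x hx y hy
    have h5 := h y hy x hx
    rw [h1, abs_le]
    constructor <;> nlinarith
  have bound : ∀ n : ℕ, 0 < n → |F q - F 0| ≤ (g q - g 0) * q / n := by
    intro n hn
    have hn' : (0 : ℝ) < n := by exact_mod_cast hn
    set p : ℕ → ℝ := fun i => q * i / n with hp
    have hmem : ∀ i ≤ n, p i ∈ Icc 0 q := by
      intro i hi
      have : (i : ℝ) ≤ n := by exact_mod_cast hi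
      refine ⟨by positivity, ?_⟩
      rw [hp]; simp only; rw [div_le_iff₀ hn']; gcongr
    have hstep : ∀ i, p (i + 1) - p i = q / n := by
      intro i; simp only [hp]; push_cast; field_simp; ring
    have e1 : F q - F 0 = ∑ i ∈ Finset.range n, (F (p (i + 1)) - F (p i)) := by
      rw [Finset.sum_range_sub (fun i => F (p i))]
      simp [hp, hn'.ne']
    have e2 : g q - g 0 = ∑ i ∈ Finset.range n, (g (p (i + 1)) - g (p i)) := by
      rw [Finset.sum_range_sub (fun i => g (p i))]
      simp [hp, hn'.ne']
    rw [e1, e2, mul_div_assoc, Finset.sum_mul]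
    refine (Finset.abs_sum_le_sum_abs _ _).trans (Finset.sum_le_sum fun i hi => ?_)
    have hi' := Finset.mem_range.1 hi
    rw [← hstep i]
    refine key _ (hmem i hi'.le) _ (hmem (i + 1) hi') ?_
    have := hstep i
    have : 0 ≤ q / n := by positivity
    linarith
  have hz : |F q - F 0| ≤ 0 := by
    have ht : Filter.Tendsto (fun n : ℕ => (g q - g 0) * q / n) Filter.atTop (nhds 0) :=
      tendsto_const_div_atTop_nhds_zero_nat _
    exact ge_of_tendsto ht (Filter.eventually_atTop.2 ⟨1, fun n hn => bound n hn⟩)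
  have := abs_nonpos_iff.1 hz
  simp only [hF, intervalIntegral.integral_same] at this
  linarith

/-- Downward incentive constraints bound the rent from below by the rent of the
posted prices `σ z`, the lowest type whose quality is at least `z`. -/
lemma integral_posPart_le_of_downward {T : Set ℝ} {U q : ℝ → ℝ} {v K : ℝ} (hv : 0 ≤ v)
    (hT : ∀ a ∈ T, 0 ≤ a ∧ a ≤ K) (hU : ∀ a ∈ T, 0 ≤ U a)
    (hdown : ∀ a ∈ T, ∀ b ∈ T, a < b → U a + (b - a) * q a ≤ U b)
    {σ : ℝ → ℝ} (hσmono : Monotone σ)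
    (hσ : ∀ z s, σ z < s → s ≤ K → ∃ a ∈ T, a < s ∧ z ≤ q a)
    {b : ℝ} (hb : b ∈ T) :
    ∫ z in Ioc 0 v, max (b - σ z) 0 ≤ U b := by
  have hint : ∀ s : ℝ, IntegrableOn (fun z => max (s - σ z) 0) (Ioc 0 v) := by
    intro s
    have ha : Antitone (fun z => max (s - σ z) 0) := fun x y hxy =>
      max_le_max (by linarith [hσmono hxy]) le_rfl
    exact ((ha.antitoneOn _).integrableOn_isCompact isCompact_Icc).mono_set Ioc_subset_Icc_self
  have claim : ∀ ε > 0, ∀ δ > 0, ∀ n : ℕ, ∀ b ∈ T, b ≤ n * δ →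
      ∫ z in Ioc 0 v, max (b - δ - σ z) 0 ≤ U b + ε * b := by
    intro ε hε δ hδ n
    induction n with
    | zero =>
      intro b hb hbn
      have hb0 : b = 0 := le_antisymm (by simpa using hbn) (hT b hb).1
      have : ∀ z ∈ Ioc 0 v, max (b - δ - σ z) 0 = 0 := by
        intro z _
        by_contra hne
        have hlt : σ z < b - δ := by
          by_contra hge
          exact hne (max_eq_right (by linarith))
        obtain ⟨a, ha, hab, _⟩ := hσ z _ hlt (by linarith [(hT b hb).2])
        linarith [(hT a ha).1]
      rw [setIntegral_congr_fun measurableSet_Ioc this]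
      simp only [integral_zero]
      nlinarith [hU b hb]
    | succ n ih =>
      intro b hb hbn
      have hb0 := (hT b hb).1
      set Z := {z | z ∈ Ioc 0 v ∧ σ z < b - δ} with hZ
      rcases Z.eq_empty_or_nonempty with hemp | hne
      · have : ∀ z ∈ Ioc 0 v, max (b - δ - σ z) 0 = 0 := by
          intro z hz
          have : z ∉ Z := by simp [hemp]
          refine max_eq_right ?_
          by_contra hlt
          exact this ⟨hz, by linarith⟩
        rw [setIntegral_congr_fun measurableSet_Ioc this]
        simp only [integral_zero]
        nlinarith [hU b hb]
      · have hbdd : BddAbove Z := ⟨v, fun z hz => hz.1.2⟩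
        obtain ⟨z₁, hz₁, hlt⟩ := exists_lt_of_lt_csSup hne (by linarith : sSup Z - ε < sSup Z)
        obtain ⟨a, ha, hab, hqa⟩ := hσ z₁ _ hz₁.2 (by linarith [(hT b hb).2])
        have hp0 : 0 ≤ sSup Z := hz₁.1.1.le.trans (le_csSup hbdd hz₁)
        have hpv : sSup Z ≤ v := csSup_le hne fun z hz => hz.1.2
        have hIa := ih a ha (by push_cast at hbn; linarith)
        have hle : ∫ z in Ioc 0 v, max (b - δ - σ z) 0 ≤
            ∫ z in Ioc 0 v, (max (a - δ - σ z) 0 +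
              (Ioc 0 (sSup Z)).indicator (fun _ => b - a) z) := by
          refine setIntegral_mono_on (hint _) ((hint _).add ?_) measurableSet_Ioc ?_
          · exact (integrable_const (b - a)).indicator measurableSet_Ioc
          · intro z hz
            by_cases hzZ : σ z < b - δ
            · have : z ∈ Ioc 0 (sSup Z) := ⟨hz.1, le_csSup hbdd ⟨hz, hzZ⟩⟩
              rw [indicator_of_mem this]
              refine max_le ?_ ?_
              · linarith [le_max_left (a - δ - σ z) 0]
              · linarith [le_max_right (a - δ - σ z) 0]
            · rw [max_eq_right (by linarith)]
              exact add_nonneg (le_max_right _ _)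
                (indicator_nonneg (fun _ _ => by linarith) _)
        have heq : ∫ z in Ioc 0 v, (max (a - δ - σ z) 0 +
              (Ioc 0 (sSup Z)).indicator (fun _ => b - a) z) =
            (∫ z in Ioc 0 v, max (a - δ - σ z) 0) + sSup Z * (b - a) := by
          rw [integral_add (hint _) ((integrable_const (b - a)).indicator measurableSet_Ioc),
            setIntegral_indicator measurableSet_Ioc,
            inter_eq_right.2 (Ioc_subset_Ioc_right hpv)]
          simp [hp0]
        have hd := hdown a ha b hb (by linarith)
        have : sSup Z * (b - a) ≤ (q a + ε) * (b - a) :=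
          mul_le_mul_of_nonneg_right (by linarith) (by linarith)
        nlinarith
  have hb0 := (hT b hb).1
  refine le_of_forall_pos_le_add fun η hη => ?_
  obtain ⟨ε, hε, hε'⟩ : ∃ ε > 0, ε * b ≤ η / 2 :=
    ⟨η / (2 * (b + 1)), by positivity, by
      rw [div_mul_eq_mul_div, div_le_div_iff₀ (by positivity) (by positivity)]; nlinarith⟩
  obtain ⟨δ, hδ, hδ'⟩ : ∃ δ > 0, δ * v ≤ η / 2 :=
    ⟨η / (2 * (v + 1)), by positivity, by
      rw [div_mul_eq_mul_div, div_le_div_iff₀ (by positivity) (by positivity)]; nlinarith⟩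
  obtain ⟨n, hn⟩ := exists_nat_ge (b / δ)
  have h1 := claim ε hε δ hδ n b hb (by rwa [div_le_iff₀ hδ] at hn)
  have h2 : ∫ z in Ioc 0 v, max (b - σ z) 0 ≤
      ∫ z in Ioc 0 v, (max (b - δ - σ z) 0 + δ) := by
    refine setIntegral_mono (hint _) ((hint _).add (integrable_const _)) fun z => ?_
    refine max_le ?_ ?_
    · linarith [le_max_left (b - δ - σ z) 0]
    · linarith [le_max_right (b - δ - σ z) 0]
  rw [integral_add (hint _) (integrable_const _)] at h2
  simp [hv] at h2
  nlinarith
/-- The quality levels that maximise surplus at marginal value `k`. -/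
def supply (u C : ℝ → ℝ) (k : ℝ) : Set ℝ :=
  {x | x ∈ Icc (0 : ℝ) 1 ∧ ∀ x' ∈ Icc (0 : ℝ) 1, k * u x' - C x' ≤ k * u x - C x}

lemma isCompact_graph_supply {u C : ℝ → ℝ} (hu : ContinuousOn u (Icc 0 1))
    (hC : ContinuousOn C (Icc 0 1)) {S : Set ℝ} (hS : IsCompact S) :
    IsCompact {p : ℝ × ℝ | p.1 ∈ S ∧ p.2 ∈ supply u C p.1} := by
  have hbox : IsCompact (S ×ˢ Icc (0 : ℝ) 1) := hS.prod isCompact_Icc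
  have hval : ContinuousOn (fun p : ℝ × ℝ => p.1 * u p.2 - C p.2) (S ×ˢ Icc (0 : ℝ) 1) :=
    (continuousOn_fst.mul (hu.comp continuousOn_snd fun p hp => hp.2)).sub
      (hC.comp continuousOn_snd fun p hp => hp.2)
  have heq : {p : ℝ × ℝ | p.1 ∈ S ∧ p.2 ∈ supply u C p.1} =
      (S ×ˢ Icc (0 : ℝ) 1) ∩ ⋂ x' ∈ Icc (0 : ℝ) 1,
        {p | p ∈ S ×ˢ Icc (0 : ℝ) 1 ∧ p.1 * u x' - C x' ≤ p.1 * u p.2 - C p.2} := by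
    ext p
    simp only [supply, mem_ofPred_eq, mem_inter_iff, mem_prod, mem_iInter₂]
    constructor
    · rintro ⟨h1, h2, h3⟩
      exact ⟨⟨h1, h2⟩, fun x' hx' => ⟨⟨h1, h2⟩, h3 x' hx'⟩⟩
    · rintro ⟨⟨h1, h2⟩, h3⟩
      exact ⟨h1, h2, fun x' hx' => (h3 x' hx').2⟩
  rw [heq]
  refine hbox.inter_right (isClosed_biInter fun x' _ => ?_)
  exact hbox.isClosed.isClosed_le ((continuousOn_fst.mul continuousOn_const).sub
    continuousOn_const) hval

lemma supply_nonempty {u C : ℝ → ℝ} (hu : ContinuousOn u (Icc 0 1))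
    (hC : ContinuousOn C (Icc 0 1)) (k : ℝ) : (supply u C k).Nonempty := by
  obtain ⟨x, hx, hmax⟩ := isCompact_Icc.exists_isMaxOn (nonempty_Icc.2 zero_le_one)
    ((continuousOn_const (c := k)).mul hu |>.sub hC)
  exact ⟨x, hx, fun x' hx' => hmax hx'⟩

/-- The marginal cost schedule of the convexified cost of effective quality `u x`, truncated
at `K`: the convexified cost `∫₀^q m` lies below the cost and agrees with it on `supply`. -/
lemma exists_marginal_cost {u C : ℝ → ℝ} (huc : ContinuousOn u (Icc 0 1))
    (humono : StrictMonoOn u (Icc 0 1)) (hu0 : u 0 = 0)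
    (hCc : ContinuousOn C (Icc 0 1)) (hCmono : MonotoneOn C (Icc 0 1)) (hC0 : C 0 = 0)
    {K : ℝ} (hK : 0 ≤ K) :
    ∃ m : ℝ → ℝ, Monotone m ∧ (∀ z, m z ∈ Icc 0 K) ∧
      (∀ q ∈ Icc 0 (u 1), ∃ k ≥ 0, ∀ x ∈ Icc (0 : ℝ) 1,
        k * (u x - q) + ∫ z in Ioc 0 q, m z ≤ C x) ∧
      (∀ z, m z < K → ∃ x ∈ supply u C (m z), z ≤ u x) ∧
      (∀ k ∈ Icc 0 K, ∀ x ∈ supply u C k,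
        (∀ z ≤ u x, m z ≤ k) ∧ C x = ∫ z in Ioc 0 (u x), m z) := by
  have h0 : (0 : ℝ) ∈ Icc (0 : ℝ) 1 := ⟨le_rfl, zero_le_one⟩
  have h1 : (1 : ℝ) ∈ Icc (0 : ℝ) 1 := ⟨zero_le_one, le_rfl⟩
  have hCnn : ∀ x ∈ Icc (0 : ℝ) 1, 0 ≤ C x := fun x hx => hC0 ▸ hCmono h0 hx hx.1
  have hunn : ∀ x ∈ Icc (0 : ℝ) 1, 0 ≤ u x := fun x hx => hu0 ▸ humono.monotoneOn h0 hx hx.1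
  have huv : ∀ x ∈ Icc (0 : ℝ) 1, u x ≤ u 1 := fun x hx => humono.monotoneOn hx h1 hx.2
  choose ξ hξ using supply_nonempty huc hCc
  set D : ℝ → ℝ := fun k => k * u (ξ k) - C (ξ k) with hD
  have hDge : ∀ k, ∀ x ∈ Icc (0 : ℝ) 1, k * u x - C x ≤ D k := fun k => (hξ k).2
  have hDeq : ∀ k, ∀ x ∈ supply u C k, k * u x - C x = D k := fun k x hx =>
    le_antisymm (hDge k x hx.1) (hx.2 _ (hξ k).1)
  have hD0 : D 0 = 0 := by
    have h := hDge 0 0 h0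
    have h' := hCnn _ (hξ 0).1
    simp only [hD, hC0] at h ⊢
    linarith
  have hDnn : ∀ k, 0 ≤ D k := fun k => by
    have h := hDge k 0 h0
    rw [hu0, hC0] at h
    linarith
  -- the marginal cost at `z` is the least value at which some supplied quality reaches `z`
  set A : ℝ → Set ℝ := fun z => {k | k ∈ Icc 0 K ∧ ∃ x ∈ supply u C k, z ≤ u x} with hA
  have hAc : ∀ z, IsCompact (A z) := by
    intro z
    have hg := isCompact_graph_supply huc hCc (isCompact_Icc (a := (0 : ℝ)) (b := K))
    have hcl : IsCompact {p : ℝ × ℝ | (p.1 ∈ Icc 0 K ∧ p.2 ∈ supply u C p.1) ∧ z ≤ u p.2} := by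
      have hc : ContinuousOn (fun p : ℝ × ℝ => u p.2)
          {p : ℝ × ℝ | p.1 ∈ Icc 0 K ∧ p.2 ∈ supply u C p.1} :=
        huc.comp continuousOn_snd fun p hp => hp.2.1
      have := hg.isClosed.isClosed_le (continuousOn_const (c := z)) hc
      exact hg.of_isClosed_subset this fun p hp => hp.1
    convert hcl.image continuous_fst using 1
    ext k
    simp only [hA, mem_ofPred_eq, mem_image, Prod.exists, exists_and_right, exists_eq_right]
    constructor
    · rintro ⟨hk, x, hx, hz⟩
      exact ⟨x, ⟨hk, hx⟩, hz⟩
    · rintro ⟨x, ⟨hk, hx⟩, hz⟩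
      exact ⟨hk, x, hx, hz⟩
  set A' : ℝ → Set ℝ := fun z => insert K (A z) with hA'
  have hA'mem : ∀ z, sInf (A' z) ∈ A' z := fun z =>
    ((hAc z).insert K).sInf_mem (insert_nonempty _ _)
  have hA'sub : ∀ z, A' z ⊆ Icc 0 K := fun z =>
    insert_subset ⟨hK, le_rfl⟩ fun k hk => hk.1
  have hbdd : ∀ z, BddBelow (A' z) := fun z => ⟨0, fun k hk => (hA'sub z hk).1⟩
  set m : ℝ → ℝ := fun z => sInf (A' z) with hm
  have hmK : ∀ z, m z ∈ Icc 0 K := fun z => hA'sub z (hA'mem z)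
  have hmle : ∀ z, ∀ k ∈ Icc 0 K, ∀ x ∈ supply u C k, z ≤ u x → m z ≤ k := fun z k hk x hx hz =>
    csInf_le (hbdd z) (mem_insert_of_mem _ ⟨hk, x, hx, hz⟩)
  have hmmono : Monotone m := by
    intro z z' hzz
    refine csInf_le_csInf (hbdd z) (insert_nonempty _ _) (insert_subset_insert ?_)
    rintro k ⟨hk, x, hx, hz⟩
    exact ⟨hk, x, hx, hzz.trans hz⟩
  have hmax : ∀ z ≤ u 1, ∀ k ∈ Icc 0 K, k * z - D k ≤ m z * z - D (m z) := by
    intro z hz k hk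
    rcases le_or_gt (m z) k with hle | hlt
    · rcases hA'mem z with heq | ⟨_, x, hx, hzx⟩
      · have : k = m z := le_antisymm (hk.2.trans_eq heq.symm) hle
        rw [this]
      · have e1 := hDge k x hx.1
        have e2 := hDeq (m z) x hx
        nlinarith [mul_le_mul_of_nonneg_left hzx (sub_nonneg.2 hle)]
    · have step : ∀ k', k < k' → k' < m z →
          k * z - D k ≤ m z * z - D (m z) + (m z - k') * (u 1 - z) := by
        intro k' h1 h2
        have hlt : u (ξ k') < z := by
          by_contra hge
          exact absurd (hmle z k' ⟨hk.1.trans h1.le, h2.le.trans (hmK z).2⟩ _ (hξ k')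
            (not_lt.1 hge)) (not_le.2 h2)
        have e1 : k * u (ξ k') - C (ξ k') ≤ D k := hDge k _ (hξ k').1
        have e2 : k' * u (ξ (m z)) - C (ξ (m z)) ≤ D k' := hDge k' _ (hξ (m z)).1
        have e3 : D k' = k' * u (ξ k') - C (ξ k') := rfl
        have e4 : D (m z) = m z * u (ξ (m z)) - C (ξ (m z)) := rfl
        have e5 := huv _ (hξ (m z)).1
        nlinarith [mul_le_mul_of_nonneg_left hlt.le (sub_nonneg.2 h1.le),
          mul_le_mul_of_nonneg_left e5 (sub_nonneg.2 h2.le)]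
      refine le_of_forall_pos_le_add fun ε hε => ?_
      set c := u 1 - z + 1 with hc
      have hc0 : 0 < c := by linarith
      obtain ⟨k', hk1, hk2⟩ := exists_between
        (max_lt hlt (by linarith [div_pos hε hc0] : m z - ε / c < m z))
      have h1 := lt_of_le_of_lt (le_max_left _ _) hk1
      have h2 := lt_of_le_of_lt (le_max_right _ _) hk1
      have h3 := step k' h1 hk2
      have h4 : (m z - k') * c ≤ ε := by
        rw [← le_div_iff₀ hc0]; linarith
      nlinarith
  have hB : ∀ q ∈ Icc 0 (u 1), ∫ z in Ioc 0 q, m z = m q * q - D (m q) := by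
    intro q hq
    rw [integral_Ioc_subgradient (f := fun z => m z * z - D (m z)) hq.1 hmmono]
    · have e1 := hmax 0 (hunn 1 h1) 0 ⟨le_rfl, hK⟩
      have e2 := hDnn (m 0)
      have : D (m 0) = 0 := by rw [hD0] at e1; linarith
      simp [this]
    · intro x hx y hy
      have := hmax y (hy.2.trans hq.2) (m x) (hmK x)
      linarith
  refine ⟨m, hmmono, hmK, ?_, ?_, ?_⟩
  · intro q hq
    refine ⟨m q, (hmK q).1, fun x hx => ?_⟩
    rw [hB q hq]
    have := hDge (m q) x hx
    linarith
  · intro z hz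
    rcases hA'mem z with heq | ⟨_, x, hx, hzx⟩
    · exact absurd heq hz.ne
    · exact ⟨x, hx, hzx⟩
  · intro k hk x hx
    refine ⟨fun z hz => hmle z k hk x hx hz, ?_⟩
    rw [hB _ ⟨hunn x hx.1, huv x hx.1⟩]
    have e1 := hmax (u x) (huv x hx.1) k hk
    have e2 := hDeq k x hx
    have e3 := hDge (m (u x)) x hx.1
    linarith

lemma isClosed_hypograph_survival (μ : Measure ℝ) [IsFiniteMeasure μ] :
    IsClosed {p : ℝ × ℝ | p.2 ≤ μ.real (Ici p.1)} := by
  have husc : UpperSemicontinuous fun τ => μ.real (Ici τ) := by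
    intro τ y hy
    have hlim : Filter.Tendsto (fun n : ℕ => μ.real (Ici (τ - 1 / ((n : ℝ) + 1))))
        Filter.atTop (nhds (μ.real (Ici τ))) := by
      have heq : Ici τ = ⋂ n : ℕ, Ici (τ - 1 / ((n : ℝ) + 1)) := by
        ext x
        simp only [mem_Ici, mem_iInter]
        constructor
        · intro h n
          have : 0 < 1 / ((n : ℝ) + 1) := by positivity
          linarith
        · intro h
          refine le_of_forall_pos_le_add fun ε hε => ?_
          obtain ⟨n, hn⟩ := exists_nat_one_div_lt hε
          linarith [h n]
      rw [heq]
      refine (ENNReal.tendsto_toReal (measure_ne_top _ _)).comp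
        (tendsto_measure_iInter_atTop (fun n => measurableSet_Ici.nullMeasurableSet) ?_
          ⟨0, measure_ne_top _ _⟩)
      intro i j hij
      refine Ici_subset_Ici.2 ?_
      have : 1 / ((j : ℝ) + 1) ≤ 1 / ((i : ℝ) + 1) := Nat.one_div_le_one_div hij
      linarith
    obtain ⟨n, hn⟩ := (hlim.eventually_lt_const hy).exists
    have hpos : 0 < 1 / ((n : ℝ) + 1) := by positivity
    filter_upwards [lt_mem_nhds (by linarith : τ - 1 / ((n : ℝ) + 1) < τ)] with τ' hτ'
    exact (measureReal_mono (Ici_subset_Ici.2 hτ'.le)).trans_lt hn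
  exact husc.IsClosed_hypograph

/-- The least monopoly price at marginal cost `k`: it exists, is monotone in `k`, and is lower
semicontinuous in `k`. -/
lemma exists_monopoly_price (μ : Measure ℝ) [IsProbabilityMeasure μ] (K : ℝ) :
    ∃ τ : ℝ → ℝ, (∀ k ∈ Icc 0 K, τ k ∈ Icc k K ∧ ∀ σ ≤ K,
        (σ - k) * μ.real (Ici σ) ≤ (τ k - k) * μ.real (Ici (τ k))) ∧
      MonotoneOn τ (Icc 0 K) ∧ ∀ a, IsClosed {k | k ∈ Icc 0 K ∧ τ k ≤ a} := by
  set S : ℝ → ℝ := fun τ => μ.real (Ici τ) with hS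
  have hS0 : ∀ τ, 0 ≤ S τ := fun τ => measureReal_nonneg
  have hS1 : ∀ τ, S τ ≤ 1 := fun τ => measureReal_le_one
  have hSanti : Antitone S := fun a b h => measureReal_mono (Ici_subset_Ici.2 h)
  have hyp := isClosed_hypograph_survival μ
  set R : Set (ℝ × ℝ × ℝ) := {p | (0 ≤ p.1 ∧ p.1 ≤ p.2.1 ∧ p.2.1 ≤ K) ∧
    (0 ≤ p.2.2 ∧ p.2.2 ≤ S p.2.1) ∧
    ∀ σ ∈ Iic K, (σ - p.1) * S σ ≤ (p.2.1 - p.1) * p.2.2} with hR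
  have hRc : IsCompact R := by
    have hbox : IsCompact (Icc (0 : ℝ) K ×ˢ Icc (0 : ℝ) K ×ˢ Icc (0 : ℝ) 1) :=
      isCompact_Icc.prod (isCompact_Icc.prod isCompact_Icc)
    refine hbox.of_isClosed_subset ?_ ?_
    · refine IsClosed.inter (IsClosed.inter ?_ (IsClosed.inter ?_ ?_))
        (IsClosed.inter (IsClosed.inter ?_ ?_) ?_)
      · exact isClosed_le continuous_const continuous_fst
      · exact isClosed_le continuous_fst (by fun_prop)
      · exact isClosed_le (continuous_fst.comp continuous_snd) continuous_const
      · exact isClosed_le continuous_const (continuous_snd.comp continuous_snd)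
      · exact hyp.preimage continuous_snd
      · have : {p : ℝ × ℝ × ℝ | ∀ σ ∈ Iic K, (σ - p.1) * S σ ≤ (p.2.1 - p.1) * p.2.2} =
            ⋂ σ ∈ Iic K, {p | (σ - p.1) * S σ ≤ (p.2.1 - p.1) * p.2.2} := by
          ext p; simp
        change IsClosed {p : ℝ × ℝ × ℝ | ∀ σ ∈ Iic K, (σ - p.1) * S σ ≤ (p.2.1 - p.1) * p.2.2}
        rw [this]
        exact isClosed_biInter fun σ _ => isClosed_le (by fun_prop) (by fun_prop)
    · rintro ⟨k, τ, s⟩ ⟨⟨h1, h2, h3⟩, ⟨h4, h5⟩, _⟩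
      exact ⟨⟨h1, h2.trans h3⟩, ⟨h1.trans h2, h3⟩, h4, h5.trans (hS1 _)⟩
  set P : ℝ → Set ℝ := fun k => {τ | τ ∈ Icc k K ∧ ∀ σ ≤ K, (σ - k) * S σ ≤ (τ - k) * S τ}
    with hP
  have hRP : ∀ k τ s, (k, τ, s) ∈ R → τ ∈ P k := by
    rintro k τ s ⟨⟨_, h2, h3⟩, ⟨_, h5⟩, h6⟩
    refine ⟨⟨h2, h3⟩, fun σ hσ => (h6 σ hσ).trans ?_⟩
    exact mul_le_mul_of_nonneg_left h5 (sub_nonneg.2 h2)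
  have hPR : ∀ k, 0 ≤ k → ∀ τ ∈ P k, (k, τ, S τ) ∈ R := by
    rintro k hk τ ⟨⟨h2, h3⟩, h6⟩
    exact ⟨⟨hk, h2, h3⟩, ⟨hS0 _, le_rfl⟩, fun σ hσ => h6 σ hσ⟩
  have hPc : ∀ k ∈ Icc 0 K, IsCompact (P k) := by
    intro k hk
    have hc : IsCompact (R ∩ {p | p.1 = k}) :=
      hRc.inter_right (isClosed_eq continuous_fst continuous_const)
    convert hc.image (continuous_fst.comp continuous_snd) using 1
    ext τ
    constructor
    · intro hτ
      exact ⟨(k, τ, S τ), ⟨hPR k hk.1 τ hτ, rfl⟩, rfl⟩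
    · rintro ⟨⟨k', τ', s⟩, ⟨hp, rfl⟩, rfl⟩
      exact hRP _ _ _ hp
  have hPne : ∀ k ∈ Icc 0 K, (P k).Nonempty := by
    intro k hk
    have hc : IsCompact ((Icc k K ×ˢ Icc (0 : ℝ) 1) ∩ {p : ℝ × ℝ | p.2 ≤ S p.1}) :=
      (isCompact_Icc.prod isCompact_Icc).inter_right hyp
    obtain ⟨⟨τ, s⟩, ⟨⟨hτ, hs⟩, hsS⟩, hmax⟩ := hc.exists_isMaxOn
      ⟨(K, 0), ⟨⟨⟨hk.2, le_rfl⟩, ⟨le_rfl, zero_le_one⟩⟩, hS0 K⟩⟩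
      (f := fun p => (p.1 - k) * p.2) (by fun_prop)
    refine ⟨τ, hτ, fun σ hσ => ?_⟩
    have hle : (τ - k) * s ≤ (τ - k) * S τ :=
      mul_le_mul_of_nonneg_left hsS (sub_nonneg.2 hτ.1)
    rcases le_or_gt k σ with h | h
    · have hm : ((σ, S σ) : ℝ × ℝ) ∈ (Icc k K ×ˢ Icc (0 : ℝ) 1) ∩ {p : ℝ × ℝ | p.2 ≤ S p.1} :=
        ⟨⟨⟨h, hσ⟩, ⟨hS0 _, hS1 _⟩⟩, le_refl (S σ)⟩
      exact (hmax hm).trans hle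
    · exact (mul_nonpos_of_nonpos_of_nonneg (by linarith) (hS0 _)).trans
        (mul_nonneg (sub_nonneg.2 hτ.1) (hS0 _))
  have hmem : ∀ k ∈ Icc 0 K, sInf (P k) ∈ P k := fun k hk =>
    (hPc k hk).sInf_mem (hPne k hk)
  have hlb : ∀ k, ∀ τ ∈ P k, sInf (P k) ≤ τ := fun k τ hτ =>
    csInf_le ⟨k, fun _ h => h.1.1⟩ hτ
  refine ⟨fun k => sInf (P k), fun k hk => hmem k hk, ?_, ?_⟩
  · intro k hk k' hk' hkk
    rcases hkk.eq_or_lt with rfl | hlt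
    · exact le_rfl
    by_contra hcon
    have hcon : sInf (P k') < sInf (P k) := not_le.1 hcon
    set τ := sInf (P k)
    set τ' := sInf (P k')
    have h1 := hmem k hk
    have h2 := hmem k' hk'
    have h3 : (τ' - k) * S τ' < (τ - k) * S τ := by
      by_contra hge
      refine absurd (hlb k τ' ⟨⟨hkk.trans h2.1.1, h2.1.2⟩, fun σ hσ => ?_⟩) (not_le.2 hcon)
      exact (h1.2 σ hσ).trans (not_lt.1 hge)
    have h4 := h2.2 τ h1.1.2
    have h5 := hSanti hcon.le
    nlinarith
  · intro a
    have hc : IsCompact (R ∩ {p | p.2.1 ≤ a}) :=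
      hRc.inter_right (isClosed_le (by fun_prop) continuous_const)
    convert (hc.image continuous_fst).isClosed using 1
    ext k
    constructor
    · rintro ⟨hk, hka⟩
      exact ⟨_, ⟨hPR k hk.1 _ (hmem k hk), hka⟩, rfl⟩
    · rintro ⟨⟨k', τ, s⟩, ⟨hp, hτ⟩, rfl⟩
      have := hRP _ _ _ hp
      exact ⟨⟨hp.1.1, hp.1.2.1.trans hp.1.2.2⟩, (hlb _ τ this).trans hτ⟩

/-- Posted prices `τ z` for every unit `z` of effective quality, each a monopoly price at the
marginal cost `m z`, that can be implemented without lotteries. -/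
lemma exists_optimal_prices {u C : ℝ → ℝ} (huc : ContinuousOn u (Icc 0 1))
    (humono : StrictMonoOn u (Icc 0 1)) (hu0 : u 0 = 0)
    (hCc : ContinuousOn C (Icc 0 1)) (hCmono : MonotoneOn C (Icc 0 1)) (hC0 : C 0 = 0)
    (μ : Measure ℝ) [IsProbabilityMeasure μ] {K : ℝ} (hK : 0 ≤ K) :
    ∃ m τ : ℝ → ℝ, Monotone m ∧ Monotone τ ∧ (∀ z, m z ∈ Icc 0 K) ∧
      (∀ z, τ z ∈ Icc (m z) K) ∧
      (∀ q ∈ Icc 0 (u 1), ∃ k ≥ 0, ∀ x ∈ Icc (0 : ℝ) 1,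
        k * (u x - q) + ∫ z in Ioc 0 q, m z ≤ C x) ∧
      (∀ z, ∀ σ ≤ K, (σ - m z) * μ.real (Ici σ) ≤ (τ z - m z) * μ.real (Ici (τ z))) ∧
      (∀ a < K, ∃ x ∈ Icc (0 : ℝ) 1,
        u x = ∫ z in Ioc 0 (u 1), (if τ z ≤ a then (1 : ℝ) else 0) ∧
        C x = ∫ z in Ioc 0 (u 1), (if τ z ≤ a then m z else 0)) := by
  obtain ⟨m, hmmono, hmK, hcost, hsup, hcontact⟩ :=
    exists_marginal_cost huc humono hu0 hCc hCmono hC0 hK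
  obtain ⟨p, hp, hpmono, hpcl⟩ := exists_monopoly_price μ K
  refine ⟨m, fun z => p (m z), hmmono, fun z z' h => hpmono (hmK z) (hmK z') (hmmono h), hmK,
    fun z => (hp _ (hmK z)).1, hcost, fun z => (hp _ (hmK z)).2, fun a ha => ?_⟩
  have hsub : ∀ z, p (m z) ≤ a → m z < K := fun z hz =>
    ((hp _ (hmK z)).1.1.trans hz).trans_lt ha
  have hSc : IsCompact {k | k ∈ Icc 0 K ∧ p k ≤ a} :=
    isCompact_Icc.of_isClosed_subset (hpcl a) fun k hk => hk.1
  have hgc := isCompact_graph_supply huc hCc hSc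
  set G := {r : ℝ × ℝ | r.1 ∈ {k | k ∈ Icc 0 K ∧ p k ≤ a} ∧ r.2 ∈ supply u C r.1} with hG
  rcases G.eq_empty_or_nonempty with hemp | hne
  · have hnot : ∀ z, ¬ p (m z) ≤ a := by
      intro z hz
      obtain ⟨x, hx, _⟩ := hsup z (hsub z hz)
      have : (m z, x) ∈ G := ⟨⟨hmK z, hz⟩, hx⟩
      simp [hemp] at this
    exact ⟨0, ⟨le_rfl, zero_le_one⟩, by simp [hnot, hu0], by simp [hnot, hC0]⟩
  · have hc : ContinuousOn (fun r : ℝ × ℝ => u r.2) G :=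
      huc.comp continuousOn_snd fun r hr => hr.2.1
    obtain ⟨⟨k, x⟩, ⟨⟨hk, hka⟩, hx⟩, hmax⟩ := hgc.exists_isMaxOn hne hc
    have hx1 : u x ≤ u 1 := humono.monotoneOn hx.1 ⟨zero_le_one, le_rfl⟩ hx.1.2
    have hx0 : 0 ≤ u x := hu0 ▸ humono.monotoneOn ⟨le_rfl, zero_le_one⟩ hx.1 hx.1.1
    obtain ⟨hle, hCx⟩ := hcontact k hk x hx
    have hiff : ∀ z, p (m z) ≤ a ↔ z ≤ u x := by
      intro z
      constructor
      · intro hz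
        obtain ⟨x', hx', hzx⟩ := hsup z (hsub z hz)
        exact hzx.trans (hmax (⟨⟨hmK z, hz⟩, hx'⟩ : (m z, x') ∈ G))
      · intro hz
        exact (hpmono (hmK z) hk (hle z hz)).trans hka
    have hint : ∀ f : ℝ → ℝ, ∫ z in Ioc 0 (u 1), (if p (m z) ≤ a then f z else 0) =
        ∫ z in Ioc 0 (u x), f z := by
      intro f
      have : ∀ z, (if p (m z) ≤ a then f z else 0) = (Iic (u x)).indicator f z := by
        intro z
        simp only [indicator, mem_Iic, hiff]
      simp only [this]
      rw [setIntegral_indicator measurableSet_Iic, Ioc_inter_Iic, min_eq_right hx1]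
    refine ⟨x, hx.1, ?_, ?_⟩
    · rw [hint]; simp [hx0]
    · rw [hint, hCx]

/-- The seller's payoff from a type `a` of a downward incentive compatible allocation is at
most the profit from the posted prices `σ z`. -/
lemma profit_le_of_rent {q U c a v k : ℝ} {m σ : ℝ → ℝ} (ha : 0 ≤ a) (hv : 0 ≤ v) (hqv : q ≤ v)
    (hm : Monotone m) (hm0 : ∀ z, 0 ≤ m z) (hσm : Monotone σ)
    (hσ : ∀ z ≤ q, σ z ≤ a)
    (hU : ∫ z in Ioc 0 v, max (a - σ z) 0 ≤ U)
    (hc : k * (q - max q 0) + ∫ z in Ioc 0 (max q 0), m z ≤ c) (hc0 : 0 ≤ c) :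
    a * q - U - c ≤ ∫ z in Ioc 0 v, (if σ z ≤ a then max (σ z - m z) 0 else 0) := by
  have hmi : IntegrableOn m (Ioc 0 v) :=
    ((hm.monotoneOn _).integrableOn_isCompact isCompact_Icc).mono_set Ioc_subset_Icc_self
  have hσi : IntegrableOn σ (Ioc 0 v) :=
    ((hσm.monotoneOn _).integrableOn_isCompact isCompact_Icc).mono_set Ioc_subset_Icc_self
  have hai : IntegrableOn (fun z => max (a - σ z) 0) (Ioc 0 v) :=
    ((integrable_const a).sub hσi).pos_part
  have hset : MeasurableSet {z | σ z ≤ a} := measurableSet_le hσm.measurable measurable_const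
  have hri : IntegrableOn (fun z => if σ z ≤ a then max (σ z - m z) 0 else 0) (Ioc 0 v) := by
    have : (fun z => if σ z ≤ a then max (σ z - m z) 0 else 0) =
        {z | σ z ≤ a}.indicator (fun z => max (σ z - m z) 0) := by
      ext z; simp [indicator]
    rw [this]
    exact (hσi.sub hmi).pos_part.indicator hset
  set q' := max q 0 with hq'
  have hq'0 : 0 ≤ q' := le_max_right _ _
  have hqq' : q ≤ q' := le_max_left _ _
  have hq'v : q' ≤ v := max_le hqv hv
  have hcost : ∫ z in Ioc 0 q', m z ≤ c := by
    rcases le_total 0 q with h | h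
    · have : q' = q := max_eq_left h
      rw [this] at hc ⊢
      simpa using hc
    · have : q' = 0 := max_eq_right h
      rw [this]
      simpa using hc0
  have hind : IntegrableOn ((Iic q').indicator fun z => a - m z) (Ioc 0 v) :=
    ((integrable_const a).sub hmi).indicator measurableSet_Iic
  have e1 : ∫ z in Ioc 0 v, (Iic q').indicator (fun z => a - m z) z =
      a * q' - ∫ z in Ioc 0 q', m z := by
    rw [setIntegral_indicator measurableSet_Iic, Ioc_inter_Iic, min_eq_right hq'v,
      integral_sub (integrable_const a)
        (hmi.mono_set (Ioc_subset_Ioc_right hq'v))]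
    simp [hq'0, mul_comm]
  have e2 : ∫ z in Ioc 0 v, ((Iic q').indicator (fun z => a - m z) z - max (a - σ z) 0) ≤
      ∫ z in Ioc 0 v, (if σ z ≤ a then max (σ z - m z) 0 else 0) := by
    refine setIntegral_mono_on (hind.sub hai) hri measurableSet_Ioc fun z hz => ?_
    have hmz := hm0 z
    by_cases hzq : z ≤ q'
    · have hzq2 : z ≤ q := by
        rcases le_max_iff.1 hzq with h | h
        · exact h
        · exact absurd h (not_le.2 hz.1)
      have hs := hσ z hzq2
      rw [indicator_of_mem (mem_Iic.2 hzq), if_pos hs, max_eq_left (sub_nonneg.2 hs)]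
      linarith [le_max_left (σ z - m z) 0]
    · rw [indicator_of_notMem (by simpa using hzq)]
      have := le_max_right (a - σ z) 0
      split_ifs
      · linarith [le_max_right (σ z - m z) 0]
      · linarith
  rw [integral_sub hind hai, e1] at e2
  have := mul_le_mul_of_nonneg_left hqq' ha
  linarith

/-- Averaging the sales of units `z` with value `g z` and price `σ z` over the buyers with law
`μ`. -/
lemma integral_integral_posted (μ : Measure ℝ) [IsProbabilityMeasure μ] {g σ : ℝ → ℝ}
    (hg : Measurable g) (hσ : Measurable σ) {M : ℝ} (hM : ∀ z, |g z| ≤ M) (v : ℝ) :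
    Integrable (fun a => ∫ z in Ioc 0 v, (if σ z ≤ a then g z else 0)) μ ∧
      ∫ a, (∫ z in Ioc 0 v, (if σ z ≤ a then g z else 0)) ∂μ =
        ∫ z in Ioc 0 v, g z * μ.real (Ici (σ z)) := by
  have hmeas : Measurable fun p : ℝ × ℝ => if σ p.2 ≤ p.1 then g p.2 else 0 :=
    Measurable.ite (measurableSet_le (hσ.comp measurable_snd) measurable_fst)
      (hg.comp measurable_snd) measurable_const
  have hint : Integrable (fun p : ℝ × ℝ => if σ p.2 ≤ p.1 then g p.2 else 0)
      (μ.prod (volume.restrict (Ioc 0 v))) := by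
    refine Integrable.of_bound hmeas.aestronglyMeasurable M (Filter.Eventually.of_forall ?_)
    intro p
    rw [Real.norm_eq_abs]
    split_ifs
    · exact hM _
    · simpa using (abs_nonneg _).trans (hM p.2)
  refine ⟨hint.integral_prod_left, ?_⟩
  rw [integral_integral_swap hint]
  refine integral_congr_ae (Filter.Eventually.of_forall fun z => ?_)
  have : (fun a => if σ z ≤ a then g z else 0) = (Ici (σ z)).indicator fun _ => g z := by
    ext a; simp [indicator]
  simp only [this]
  rw [integral_indicator_const _ measurableSet_Ici, smul_eq_mul, mul_comm]

/-- Expected profit from a downward incentive compatible allocation is at most the profit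
from the monopoly prices `τ z`. -/
lemma integral_profit_le {μ : Measure ℝ} [IsProbabilityMeasure μ] {K v : ℝ} (hv : 0 ≤ v)
    {m τ : ℝ → ℝ} (hm : Monotone m) (hτ : Monotone τ) (hmK : ∀ z, m z ∈ Icc 0 K)
    (hτK : ∀ z, τ z ∈ Icc (m z) K)
    (hopt : ∀ z, ∀ σ ≤ K,
      (σ - m z) * μ.real (Ici σ) ≤ (τ z - m z) * μ.real (Ici (τ z)))
    {T : Set ℝ} {U q c : ℝ → ℝ} (hT : ∀ a ∈ T, 0 ≤ a ∧ a ≤ K) (hU : ∀ a ∈ T, 0 ≤ U a)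
    (hqv : ∀ a ∈ T, q a ≤ v)
    (hdown : ∀ a ∈ T, ∀ b ∈ T, a < b → U a + (b - a) * q a ≤ U b)
    (hc0 : ∀ a ∈ T, 0 ≤ c a)
    (hc : ∀ a ∈ T, ∀ q' ∈ Icc 0 v, ∃ k, k * (q a - q') + ∫ z in Ioc 0 q', m z ≤ c a)
    (hTae : ∀ᵐ a ∂μ, a ∈ T) (hint : Integrable (fun a => a * q a - U a - c a) μ) :
    ∫ a, (a * q a - U a - c a) ∂μ ≤
      ∫ a, (∫ z in Ioc 0 v, (if τ z ≤ a then τ z - m z else 0)) ∂μ := by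
  set A : ℝ → Set ℝ := fun z => insert K {a | a ∈ T ∧ z ≤ q a} with hA
  have hlb : ∀ z, 0 ∈ lowerBounds (A z) := by
    intro z a ha
    rcases ha with rfl | ha
    · exact (hmK 0).1.trans (hmK 0).2
    · exact (hT a ha.1).1
  have hbdd : ∀ z, BddBelow (A z) := fun z => ⟨0, hlb z⟩
  have hne : ∀ z, (A z).Nonempty := fun z => insert_nonempty _ _
  set σ : ℝ → ℝ := fun z => sInf (A z) with hσ
  have hσ0 : ∀ z, 0 ≤ σ z := fun z => le_csInf (hne z) fun a ha => hlb z ha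
  have hσK : ∀ z, σ z ≤ K := fun z => csInf_le (hbdd z) (mem_insert _ _)
  have hσmono : Monotone σ := by
    intro z z' h
    refine csInf_le_csInf (hbdd z) (hne z') (insert_subset_insert ?_)
    rintro a ⟨ha, hq⟩
    exact ⟨ha, h.trans hq⟩
  have hσlt : ∀ z s, σ z < s → s ≤ K → ∃ a ∈ T, a < s ∧ z ≤ q a := by
    intro z s hs hsK
    obtain ⟨a, ha, has⟩ := exists_lt_of_csInf_lt (hne z) hs
    rcases ha with rfl | ha
    · exact absurd hsK (not_le.2 has)
    · exact ⟨a, ha.1, has, ha.2⟩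
  have hbound : ∀ z, |max (σ z - m z) 0| ≤ K := by
    intro z
    rw [abs_of_nonneg (le_max_right _ _)]
    exact max_le (by linarith [hσK z, (hmK z).1]) ((hσ0 z).trans (hσK z))
  have hbound' : ∀ z, |τ z - m z| ≤ K := by
    intro z
    rw [abs_of_nonneg (sub_nonneg.2 (hτK z).1)]
    linarith [(hτK z).2, (hmK z).1]
  obtain ⟨hI, hE⟩ := integral_integral_posted μ (g := fun z => max (σ z - m z) 0)
    ((hσmono.measurable.sub hm.measurable).max measurable_const) hσmono.measurable hbound v
  obtain ⟨-, hE'⟩ := integral_integral_posted μ (g := fun z => τ z - m z)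
    (hτ.measurable.sub hm.measurable) hτ.measurable hbound' v
  have hle : ∫ a, (a * q a - U a - c a) ∂μ ≤
      ∫ a, (∫ z in Ioc 0 v, (if σ z ≤ a then max (σ z - m z) 0 else 0)) ∂μ := by
    refine integral_mono_ae hint hI ?_
    filter_upwards [hTae] with a ha
    obtain ⟨k, hk⟩ := hc a ha (max (q a) 0) ⟨le_max_right _ _, max_le (hqv a ha) hv⟩
    refine profit_le_of_rent (hT a ha).1 hv (hqv a ha) hm (fun z => (hmK z).1) hσmono ?_ ?_
      hk (hc0 a ha)
    · exact fun z hz => csInf_le (hbdd z) (mem_insert_of_mem _ ⟨ha, hz⟩)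
    · exact integral_posPart_le_of_downward hv hT hU hdown hσmono hσlt ha
  have hsurv : ∀ f : ℝ → ℝ, Monotone f → Measurable fun z => μ.real (Ici (f z)) := by
    intro f hf
    have : Antitone fun z => μ.real (Ici (f z)) := fun z z' h =>
      measureReal_mono (Ici_subset_Ici.2 (hf h))
    exact this.measurable
  have hprod : ∀ f g : ℝ → ℝ, Measurable f → Monotone g → (∀ z, |f z| ≤ K) →
      IntegrableOn (fun z => f z * μ.real (Ici (g z))) (Ioc 0 v) := by
    intro f g hf hg hfK
    refine Integrable.of_bound (hf.mul (hsurv g hg)).aestronglyMeasurable K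
      (Filter.Eventually.of_forall fun z => ?_)
    rw [norm_mul, Real.norm_eq_abs, Real.norm_of_nonneg measureReal_nonneg]
    exact (mul_le_of_le_one_right (abs_nonneg _) measureReal_le_one).trans (hfK z)
  refine hle.trans ?_
  rw [hE, hE']
  refine setIntegral_mono
    (hprod (fun z => max (σ z - m z) 0) σ
      ((hσmono.measurable.sub hm.measurable).max measurable_const) hσmono hbound)
    (hprod (fun z => τ z - m z) τ (hτ.measurable.sub hm.measurable) hτ hbound') fun z => ?_
  rcases le_total (σ z - m z) 0 with h | h
  · simp only [max_eq_right h, zero_mul]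
    exact mul_nonneg (sub_nonneg.2 (hτK z).1) measureReal_nonneg
  · simp only [max_eq_left h]
    exact hopt z (σ z) (hσK z)

/-- Under a regular conditional distribution `κ` of the rates of substitution, a type is drawn
by first drawing its first coordinate and then the rates. -/
lemma map_compProd_rates {γ : Measure (ℝ × (Fin N → ℝ))} [IsProbabilityMeasure γ]
    (hpos : ∀ᵐ θ ∂γ, 0 < θ.1) {κ : Kernel ℝ (Fin N → ℝ)}
    (hκ : IsRCD (Measure.map
      (fun θ : ℝ × (Fin N → ℝ) => (θ.1, fun i => θ.2 i / θ.1)) γ) κ) :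
    Measure.map (fun p : ℝ × (Fin N → ℝ) => (p.1, p.1 • p.2)) (γ.fst ⊗ₘ κ) = γ := by
  have := hκ.1
  set Φ : ℝ × (Fin N → ℝ) → ℝ × (Fin N → ℝ) := fun θ => (θ.1, fun i => θ.2 i / θ.1) with hΦ
  have hΦm : Measurable Φ := by
    refine measurable_fst.prodMk (measurable_pi_lambda _ fun i => ?_)
    exact ((measurable_pi_apply i).comp measurable_snd).div measurable_fst
  have hψm : Measurable fun p : ℝ × (Fin N → ℝ) => (p.1, p.1 • p.2) :=
    measurable_fst.prodMk (measurable_fst.smul measurable_snd)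
  have hfst : (Measure.map Φ γ).fst = γ.fst := by
    rw [Measure.fst, Measure.map_map measurable_fst hΦm]; rfl
  have hρ : γ.fst ⊗ₘ κ = Measure.map Φ γ := by
    refine Measure.ext fun s hs => ?_
    rw [Measure.compProd_apply hs, hκ.2 s hs, hfst]
    rfl
  rw [hρ, Measure.map_map hψm hΦm]
  conv_rhs => rw [← Measure.map_id (μ := γ)]
  refine Measure.map_congr ?_
  filter_upwards [hpos] with θ hθ
  refine Prod.ext rfl (funext fun i => ?_)
  simp [hΦ, mul_div_cancel₀, hθ.ne']

/-- A stochastic dominance comparison of two functions separated by a supremum of nondecreasing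
affine functions. -/
lemma integral_le_of_affine_support {ι : Type*} [Nonempty ι] {ν ν' : Measure (Fin N → ℝ)}
    [IsProbabilityMeasure ν] [IsProbabilityMeasure ν']
    (hdom : ∀ f : (Fin N → ℝ) → ℝ, Measurable f → Monotone f → (∃ M, ∀ b, |f b| ≤ M) →
      ∫ b, f b ∂ν ≤ ∫ b, f b ∂ν')
    {p : ι → ℝ} {w : ι → Fin N → ℝ} (hw : ∀ j i, 0 ≤ w j i) {g g' : (Fin N → ℝ) → ℝ} {M : ℝ}
    (hgi : Integrable g ν) (hgi' : Integrable g' ν') (hgM : ∀ᵐ r ∂ν, g r ≤ M)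
    (hg : ∀ᵐ r ∂ν, ∃ j, g r ≤ p j + ∑ i, r i * w j i)
    (hg0' : ∀ᵐ r ∂ν', 0 ≤ g' r)
    (hg' : ∀ᵐ r ∂ν', ∀ j, p j + ∑ i, r i * w j i ≤ g' r) :
    ∫ r, g r ∂ν ≤ ∫ r, g' r ∂ν' := by
  set F : ι → (Fin N → ℝ) → ℝ := fun j r => max 0 (min M (p j + ∑ i, r i * w j i)) with hF
  set f : (Fin N → ℝ) → ℝ := fun r => ⨆ j, F j r with hf
  have hFle : ∀ j r, F j r ≤ max 0 M := fun j r => max_le_max le_rfl (min_le_left _ _)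
  have hbdd : ∀ r, BddAbove (range fun j => F j r) := fun r =>
    ⟨max 0 M, by rintro _ ⟨j, rfl⟩; exact hFle j r⟩
  have hf0 : ∀ r, 0 ≤ f r := fun r =>
    (le_max_left _ _).trans (le_ciSup (hbdd r) (Classical.arbitrary ι))
  have hfle : ∀ r, f r ≤ max 0 M := fun r => ciSup_le fun j => hFle j r
  have hfb : ∀ r, |f r| ≤ max 0 M := fun r => (abs_of_nonneg (hf0 r)).le.trans (hfle r)
  have hfm : Measurable f := by
    refine (lowerSemicontinuous_ciSup hbdd fun j => Continuous.lowerSemicontinuous ?_).measurable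
    fun_prop
  have hfmono : Monotone f := by
    intro r r' h
    refine ciSup_mono (hbdd r') fun j => max_le_max le_rfl (min_le_min le_rfl ?_)
    gcongr with i
    · exact hw j i
    · exact h i
  have hfi : ∀ ν : Measure (Fin N → ℝ), IsProbabilityMeasure ν → Integrable f ν := fun ν _ =>
    Integrable.of_bound hfm.aestronglyMeasurable (max 0 M) (Filter.Eventually.of_forall hfb)
  calc ∫ r, g r ∂ν ≤ ∫ r, f r ∂ν := by
        refine integral_mono_ae hgi (hfi ν inferInstance) ?_
        filter_upwards [hgM, hg] with r h1 ⟨j, h2⟩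
        exact (le_max_of_le_right (le_min h1 h2)).trans (le_ciSup (hbdd r) j)
    _ ≤ ∫ r, f r ∂ν' := hdom f hfm hfmono ⟨_, hfb⟩
    _ ≤ ∫ r, g' r ∂ν' := by
        refine integral_mono_ae (hfi ν' inferInstance) hgi' ?_
        filter_upwards [hg0', hg'] with r h1 h2
        exact ciSup_le fun j => max_le h1 ((min_le_right _ _).trans (h2 j))

/-- Individual rationality and incentive compatibility bound the transfers of a mechanism. -/
lemma MechanismMS.exists_abs_transfer_le {ΘA : Set ℝ} {ΘB : Set (Fin N → ℝ)}
    (hΘA : IsCompact ΘA) (hΘApos : ∀ a ∈ ΘA, 0 < a) (hΘBnonpos : ∀ b ∈ ΘB, ∀ i, b i ≤ 0)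
    (hne : (ΘA ×ˢ ΘB).Nonempty) {γ : Measure (ℝ × (Fin N → ℝ))} {u : ℝ → ℝ}
    (hu : ∀ x ∈ Icc (0 : ℝ) 1, u x ∈ Icc 0 (u 1)) {c : Y → (Fin N → ℝ)}
    (hcbdd : ∃ M, ∀ y i, |c y i| ≤ M) (hcnonneg : ∀ y i, 0 ≤ c y i)
    {x : ℝ × (Fin N → ℝ) → ℝ} {y : ℝ × (Fin N → ℝ) → Y} {t : ℝ × (Fin N → ℝ) → ℝ}
    (h : MechanismMS ΘA ΘB u c γ x y t) : ∃ L, ∀ θ ∈ ΘA ×ˢ ΘB, |t θ| ≤ L := by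
  obtain ⟨-, -, -, -, hx, hIC, hIR⟩ := h
  obtain ⟨θ₀, hθ₀⟩ := hne
  obtain ⟨M, hM⟩ := hcbdd
  obtain ⟨A, hA⟩ := hΘA.bddAbove
  set W := θ₀.1 * u (x θ₀) + (∑ i, θ₀.2 i * c (y θ₀) i) - t θ₀ with hW
  refine ⟨max (A * u 1) (W + ∑ i, |θ₀.2 i| * M), fun θ hθ => abs_le'.2 ⟨?_, ?_⟩⟩
  · refine le_max_of_le_left ?_
    have h1 := hIR θ hθ
    have h2 : ∑ i, θ.2 i * c (y θ) i ≤ 0 :=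
      Finset.sum_nonpos fun i _ => mul_nonpos_of_nonpos_of_nonneg (hΘBnonpos _ hθ.2 i)
        (hcnonneg _ i)
    have h3 : θ.1 * u (x θ) ≤ A * u 1 :=
      mul_le_mul (hA hθ.1) (hu _ (hx θ hθ)).2 (hu _ (hx θ hθ)).1
        ((hΘApos _ hθ.1).le.trans (hA hθ.1))
    linarith
  · refine le_max_of_le_right ?_
    have h1 := hIC θ₀ hθ₀ θ hθ
    have h2 : 0 ≤ θ₀.1 * u (x θ) := mul_nonneg (hΘApos _ hθ₀.1).le (hu _ (hx θ hθ)).1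
    have h3 : -∑ i, |θ₀.2 i| * M ≤ ∑ i, θ₀.2 i * c (y θ) i := by
      rw [← Finset.sum_neg_distrib]
      refine Finset.sum_le_sum fun i _ => ?_
      refine neg_le_of_abs_le ?_
      rw [abs_mul]
      exact mul_le_mul_of_nonneg_left (hM _ _) (abs_nonneg _)
    linarith

/-- Averaging a mechanism over the rates of substitution, conditionally on the first coordinate
`a`, gives a downward incentive compatible allocation: rent `U`, effective quality `q` and
production cost `k`. -/
lemma MechanismMS.exists_averaged_allocation {ΘA : Set ℝ} {ΘB : Set (Fin N → ℝ)}
    (hΘA : IsCompact ΘA) (hΘApos : ∀ a ∈ ΘA, 0 < a)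
    (hΘBnonpos : ∀ b ∈ ΘB, ∀ i, b i ≤ 0)
    {γ : Measure (ℝ × (Fin N → ℝ))} [IsProbabilityMeasure γ]
    (hγ : ∀ᵐ θ ∂γ, θ ∈ ΘA ×ˢ ΘB)
    {u : ℝ → ℝ} (huc : ContinuousOn u (Icc 0 1))
    (hu : ∀ x ∈ Icc (0 : ℝ) 1, u x ∈ Icc 0 (u 1))
    {c : Y → (Fin N → ℝ)} (hcmeas : Measurable c)
    (hcbdd : ∃ M, ∀ y i, |c y i| ≤ M) (hcnonneg : ∀ y i, 0 ≤ c y i)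
    {C : ℝ → ℝ} (hCc : ContinuousOn C (Icc 0 1))
    (hC : ∀ x ∈ Icc (0 : ℝ) 1, C x ∈ Icc 0 (C 1))
    {κ : Kernel ℝ (Fin N → ℝ)}
    (hκ : IsRCD (Measure.map
      (fun θ : ℝ × (Fin N → ℝ) => (θ.1, fun i => θ.2 i / θ.1)) γ) κ)
    (hdom : ∀ a ∈ MSupport γ.fst, ∀ a' ∈ MSupport γ.fst, a < a' →
      ∀ f : (Fin N → ℝ) → ℝ, Measurable f → Monotone f → (∃ M, ∀ b, |f b| ≤ M) →
        ∫ b, f b ∂(κ a) ≤ ∫ b, f b ∂(κ a'))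
    {x : ℝ × (Fin N → ℝ) → ℝ} {y : ℝ × (Fin N → ℝ) → Y} {t : ℝ × (Fin N → ℝ) → ℝ}
    (h : MechanismMS ΘA ΘB u c γ x y t) :
    ∃ T ⊆ ΘA, ∃ U q k : ℝ → ℝ, (∀ a ∈ T, 0 ≤ U a) ∧ (∀ a ∈ T, q a ≤ u 1) ∧
      (∀ a ∈ T, ∀ b ∈ T, a < b → U a + (b - a) * q a ≤ U b) ∧ (∀ a ∈ T, 0 ≤ k a) ∧
      (∀ a ∈ T, ∀ s ≥ 0, ∀ d, (∀ x ∈ Icc (0 : ℝ) 1, s * u x + d ≤ C x) →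
        s * q a + d ≤ k a) ∧
      (∀ᵐ a ∂γ.fst, a ∈ T) ∧ Integrable (fun a => a * q a - U a - k a) γ.fst ∧
      SellerPayoff C γ x t = ∫ a, (a * q a - U a - k a) ∂γ.fst := by
  have := hκ.1
  obtain ⟨L, hL⟩ := h.exists_abs_transfer_le hΘA hΘApos hΘBnonpos hγ.exists hu hcbdd hcnonneg
  obtain ⟨hxm, hym, htm, hti, hx, hIC, hIR⟩ := h
  have hproj : Continuous fun z : ℝ => (projIcc (0 : ℝ) 1 zero_le_one z : ℝ) :=
    continuous_subtype_val.comp continuous_projIcc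
  obtain ⟨v, hvc, hvu⟩ : ∃ v : ℝ → ℝ, Continuous v ∧ ∀ z ∈ Icc (0 : ℝ) 1, v z = u z :=
    ⟨fun z => u (projIcc (0 : ℝ) 1 zero_le_one z),
      huc.comp_continuous hproj fun z => (projIcc _ _ _ z).2,
      fun z hz => by simp only [projIcc_of_mem zero_le_one hz]⟩
  obtain ⟨D, hDc, hDC⟩ : ∃ D : ℝ → ℝ, Continuous D ∧ ∀ z ∈ Icc (0 : ℝ) 1, D z = C z :=
    ⟨fun z => C (projIcc (0 : ℝ) 1 zero_le_one z),
      hCc.comp_continuous hproj fun z => (projIcc _ _ _ z).2,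
      fun z hz => by simp only [projIcc_of_mem zero_le_one hz]⟩
  have hψ : Measurable fun p : ℝ × (Fin N → ℝ) => (p.1, p.1 • p.2) :=
    measurable_fst.prodMk (measurable_fst.smul measurable_snd)
  have hψa : ∀ a : ℝ, Measurable fun r : Fin N → ℝ => (a, a • r) := fun a =>
    hψ.comp measurable_prodMk_left
  have hmap := map_compProd_rates (hγ.mono fun θ hθ => hΘApos _ hθ.1) hκ
  set qq : ℝ → (Fin N → ℝ) → ℝ := fun a r =>
    v (x (a, a • r)) + ∑ i, r i * c (y (a, a • r)) i with hqq
  set UU : ℝ → (Fin N → ℝ) → ℝ := fun a r => a * qq a r - t (a, a • r) with hUU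
  set T : Set ℝ := {a | a ∈ ΘA ∧ a ∈ MSupport γ.fst ∧ ∀ᵐ r ∂κ a, (a, a • r) ∈ ΘA ×ˢ ΘB} with hT
  have hqqm : ∀ a, Measurable (qq a) := by
    intro a
    refine (hvc.measurable.comp (hxm.comp (hψa a))).add (Finset.measurable_sum _ fun i _ => ?_)
    exact (measurable_pi_apply i).mul
      ((measurable_pi_apply i).comp (hcmeas.comp (hym.comp (hψa a))))
  have hscale : ∀ (b : ℝ) (r w : Fin N → ℝ), ∑ i, (b • r) i * w i = b * ∑ i, r i * w i := by
    intro b r w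
    rw [Finset.mul_sum]
    exact Finset.sum_congr rfl fun i _ => by simp [mul_assoc]
  have hUUeq : ∀ a r, (a, a • r) ∈ ΘA ×ˢ ΘB → UU a r = a * u (x (a, a • r)) +
      (∑ i, (a • r) i * c (y (a, a • r)) i) - t (a, a • r) := by
    intro a r hr
    simp only [hUU, hqq]
    rw [hscale, hvu _ (hx _ hr)]
    ring
  have hUU0 : ∀ a r, (a, a • r) ∈ ΘA ×ˢ ΘB → 0 ≤ UU a r := fun a r hr => by
    rw [hUUeq a r hr]; exact hIR _ hr
  have hsum : ∀ a r, (a, a • r) ∈ ΘA ×ˢ ΘB → ∑ i, r i * c (y (a, a • r)) i ≤ 0 := by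
    intro a r hr
    refine Finset.sum_nonpos fun i _ => mul_nonpos_of_nonpos_of_nonneg ?_ (hcnonneg _ i)
    have h1 : a * r i ≤ 0 := hΘBnonpos _ hr.2 i
    have h2 : 0 < a := hΘApos _ hr.1
    by_contra hcon
    linarith [mul_pos h2 (not_le.1 hcon)]
  have hqqu : ∀ a r, (a, a • r) ∈ ΘA ×ˢ ΘB → qq a r ≤ u (x (a, a • r)) := by
    intro a r hr
    simp only [hqq]
    rw [hvu _ (hx _ hr)]
    linarith [hsum a r hr]
  have hqqv : ∀ a r, (a, a • r) ∈ ΘA ×ˢ ΘB → qq a r ≤ u 1 := fun a r hr =>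
    (hqqu a r hr).trans (hu _ (hx _ hr)).2
  have hqql : ∀ a r, (a, a • r) ∈ ΘA ×ˢ ΘB → -(L / a) ≤ qq a r := by
    intro a r hr
    have h1 : 0 ≤ a * qq a r - t (a, a • r) := hUU0 a r hr
    have h2 := (abs_le.1 (hL _ hr)).1
    rw [← neg_div, div_le_iff₀ (hΘApos a hr.1)]
    linarith
  have hqqi : ∀ a ∈ T, Integrable (qq a) (κ a) := by
    intro a ha
    refine Integrable.of_bound (hqqm a).aestronglyMeasurable (max (u 1) (L / a)) ?_
    filter_upwards [ha.2.2] with r hr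
    rw [Real.norm_eq_abs, abs_le']
    exact ⟨le_max_of_le_left (hqqv a r hr), le_max_of_le_right (by linarith [hqql a r hr])⟩
  have htai : ∀ a ∈ T, Integrable (fun r => t (a, a • r)) (κ a) := by
    intro a ha
    refine Integrable.of_bound (htm.comp (hψa a)).aestronglyMeasurable L ?_
    filter_upwards [ha.2.2] with r hr using hL _ hr
  have hUUi : ∀ a ∈ T, Integrable (UU a) (κ a) := fun a ha =>
    ((hqqi a ha).const_mul a).sub (htai a ha)
  have hDi : ∀ a ∈ T, Integrable (fun r => D (x (a, a • r))) (κ a) := by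
    intro a ha
    refine Integrable.of_bound
      (hDc.measurable.comp (hxm.comp (hψa a))).aestronglyMeasurable (C 1) ?_
    filter_upwards [ha.2.2] with r hr
    rw [hDC _ (hx _ hr), Real.norm_eq_abs, abs_of_nonneg (hC _ (hx _ hr)).1]
    exact (hC _ (hx _ hr)).2
  have hTae : ∀ᵐ a ∂γ.fst, a ∈ T := by
    have h1 : ∀ᵐ a ∂γ.fst, a ∈ ΘA :=
      (ae_map_iff measurable_fst.aemeasurable hΘA.measurableSet).2 (hγ.mono fun θ hθ => hθ.1)
    have h2 : ∀ᵐ a ∂γ.fst, a ∈ MSupport γ.fst := by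
      filter_upwards [Measure.support_mem_ae (μ := γ.fst)] with a ha U hU haU
      exact (Measure.mem_support_iff_forall a).1 ha U (hU.mem_nhds haU)
    have h3 : ∀ᵐ a ∂γ.fst, ∀ᵐ r ∂κ a, (a, a • r) ∈ ΘA ×ˢ ΘB := by
      rw [← hmap] at hγ
      exact Measure.ae_ae_of_ae_compProd (ae_of_ae_map hψ.aemeasurable hγ)
    filter_upwards [h1, h2, h3] with a ha1 ha2 ha3 using ⟨ha1, ha2, ha3⟩
  have hprofit : ∀ a ∈ T, ∫ r, (-D (x (a, a • r)) + t (a, a • r)) ∂κ a =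
      a * (∫ r, qq a r ∂κ a) - (∫ r, UU a r ∂κ a) - ∫ r, D (x (a, a • r)) ∂κ a := by
    intro a ha
    have h1 : ∫ r, UU a r ∂κ a = a * (∫ r, qq a r ∂κ a) - ∫ r, t (a, a • r) ∂κ a := by
      rw [← integral_const_mul, ← integral_sub ((hqqi a ha).const_mul a) (htai a ha)]
    have h2 : ∫ r, (-D (x (a, a • r)) + t (a, a • r)) ∂κ a =
        (∫ r, -D (x (a, a • r)) ∂κ a) + ∫ r, t (a, a • r) ∂κ a :=
      integral_add (hDi a ha).neg (htai a ha)
    rw [h1, h2, integral_neg]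
    ring
  have hFi : Integrable (fun θ => -D (x θ) + t θ) γ := by
    refine Integrable.add (Integrable.neg ?_) hti
    refine Integrable.of_bound (hDc.measurable.comp hxm).aestronglyMeasurable (C 1) ?_
    filter_upwards [hγ] with θ hθ
    rw [hDC _ (hx _ hθ), Real.norm_eq_abs, abs_of_nonneg (hC _ (hx _ hθ)).1]
    exact (hC _ (hx _ hθ)).2
  have hFi' : Integrable (fun p : ℝ × (Fin N → ℝ) =>
      -D (x (p.1, p.1 • p.2)) + t (p.1, p.1 • p.2)) (γ.fst ⊗ₘ κ) := by
    rw [← hmap] at hFi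
    exact hFi.comp_measurable hψ
  refine ⟨T, fun a ha => ha.1, fun a => ∫ r, UU a r ∂κ a, fun a => ∫ r, qq a r ∂κ a,
    fun a => ∫ r, D (x (a, a • r)) ∂κ a, ?_, ?_, ?_, ?_, ?_, hTae, ?_, ?_⟩
  · exact fun a ha => integral_nonneg_of_ae (ha.2.2.mono fun r hr => hUU0 a r hr)
  · intro a ha
    simpa using integral_mono_ae (hqqi a ha) (integrable_const (u 1))
      (ha.2.2.mono fun r hr => hqqv a r hr)
  · intro a ha b hb hab
    have hI : Integrable (fun r => UU a r + (b - a) * qq a r) (κ a) :=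
      (hUUi a ha).add ((hqqi a ha).const_mul _)
    have heq : (∫ r, UU a r ∂κ a) + (b - a) * ∫ r, qq a r ∂κ a =
        ∫ r, (UU a r + (b - a) * qq a r) ∂κ a := by
      rw [integral_add (hUUi a ha) ((hqqi a ha).const_mul _), integral_const_mul]
    have hb0 : 0 < b := hΘApos b hb.1
    have : Nonempty (ΘA ×ˢ ΘB : Set (ℝ × (Fin N → ℝ))) :=
      nonempty_subtype.2 hγ.exists
    rw [heq]
    refine integral_le_of_affine_support (hdom a ha.2.1 b hb.2.1 hab)
      (p := fun j : (ΘA ×ˢ ΘB : Set (ℝ × (Fin N → ℝ))) => b * u (x j) - t j)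
      (w := fun j => b • c (y j)) (M := b * u 1 + L)
      (fun j i => mul_nonneg hb0.le (hcnonneg _ i)) hI (hUUi b hb) ?_ ?_ ?_ ?_
    · filter_upwards [ha.2.2] with r hr
      have h1 := mul_le_mul_of_nonneg_left (hqqv a r hr) hb0.le
      have h2 := (abs_le.1 (hL _ hr)).1
      simp only [hUU]
      linarith
    · filter_upwards [ha.2.2] with r hr
      refine ⟨⟨(a, a • r), hr⟩, le_of_eq ?_⟩
      have h1 : ∑ i, r i * (b • c (y (a, a • r))) i = b * ∑ i, r i * c (y (a, a • r)) i := by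
        rw [Finset.mul_sum]
        exact Finset.sum_congr rfl fun i _ => by simp [mul_left_comm]
      simp only [hUU, hqq]
      rw [h1, hvu _ (hx _ hr)]
      ring
    · exact hb.2.2.mono fun r hr => hUU0 b r hr
    · filter_upwards [hb.2.2] with r hr j
      have h1 : ∑ i, r i * (b • c (y j)) i = ∑ i, (b • r) i * c (y j) i :=
        Finset.sum_congr rfl fun i _ => by simp [mul_left_comm, mul_assoc]
      have h2 := hIC _ hr j j.2
      rw [hUUeq b r hr, h1]
      linarith
  · refine fun a ha => integral_nonneg_of_ae (ha.2.2.mono fun r hr => ?_)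
    simp only [Pi.zero_apply]
    rw [hDC _ (hx _ hr)]
    exact (hC _ (hx _ hr)).1
  · intro a ha s hs d hsd
    have h1 := integral_mono_ae (((hqqi a ha).const_mul s).add (integrable_const d)) (hDi a ha)
      (ha.2.2.mono fun r hr => by
        have h2 := mul_le_mul_of_nonneg_left (hqqu a r hr) hs
        have h3 := hsd _ (hx _ hr)
        simp only [Pi.add_apply]
        rw [hDC _ (hx _ hr)]
        linarith)
    simp only [Pi.add_apply] at h1
    rw [integral_add ((hqqi a ha).const_mul s) (integrable_const d), integral_const_mul] at h1
    simpa using h1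
  · have h1 : Integrable (fun a => ∫ r, (-D (x (a, a • r)) + t (a, a • r)) ∂κ a) γ.fst := by
      simpa using hFi'.integral_compProd
    exact h1.congr (hTae.mono fun a ha => hprofit a ha)
  · calc SellerPayoff C γ x t = ∫ θ, (-D (x θ) + t θ) ∂γ := by
          refine integral_congr_ae (hγ.mono fun θ hθ => ?_)
          simp only
          rw [hDC _ (hx _ hθ)]
      _ = ∫ p : ℝ × (Fin N → ℝ), (-D (x (p.1, p.1 • p.2)) + t (p.1, p.1 • p.2))
            ∂(γ.fst ⊗ₘ κ) := by
          conv_lhs => rw [← hmap]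
          exact integral_map hψ.aemeasurable
            ((hDc.measurable.comp hxm).neg.add htm).aestronglyMeasurable
      _ = ∫ a, ∫ r, (-D (x (a, a • r)) + t (a, a • r)) ∂κ a ∂γ.fst :=
          Measure.integral_compProd hFi'
      _ = _ := integral_congr_ae (hTae.mono fun a ha => hprofit a ha)

/-- Selling every unit `z` of effective quality at the posted price `τ z` is implemented by a
mechanism without costly screening. -/
lemma exists_posted_mechanism {y₀ : Y} {ΘA : Set ℝ} (ΘB : Set (Fin N → ℝ))
    (γ : Measure (ℝ × (Fin N → ℝ))) [IsProbabilityMeasure γ]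
    (hγ : ∀ᵐ θ ∂γ, θ.1 ∈ ΘA) {u : ℝ → ℝ} (humono : StrictMonoOn u (Icc 0 1))
    {c : Y → (Fin N → ℝ)} (hc0 : c y₀ = 0) {C : ℝ → ℝ} {A K : ℝ} (hA : ∀ a ∈ ΘA, a ≤ A)
    {m τ : ℝ → ℝ} (hm : Monotone m) (hτ : Monotone τ) (hmK : ∀ z, m z ∈ Icc 0 K)
    (hτK : ∀ z, τ z ∈ Icc (m z) K)
    (hX : ∀ a ≤ A, ∃ x ∈ Icc (0 : ℝ) 1,
      u x = ∫ z in Ioc 0 (u 1), (if τ z ≤ a then (1 : ℝ) else 0) ∧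
      C x = ∫ z in Ioc 0 (u 1), (if τ z ≤ a then m z else 0)) :
    ∃ x t : ℝ × (Fin N → ℝ) → ℝ, MechanismMS ΘA ΘB u c γ x (fun _ => y₀) t ∧
      (∀ θ θ' : ℝ × (Fin N → ℝ), θ.1 = θ'.1 → x θ = x θ' ∧ t θ = t θ') ∧
      SellerPayoff C γ x t =
        ∫ a, (∫ z in Ioc 0 (u 1), (if τ z ≤ a then τ z - m z else 0)) ∂γ.fst := by
  choose! X hX01 hXu hXC using hX
  have hτ0 : ∀ z, 0 ≤ τ z := fun z => (hmK z).1.trans (hτK z).1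
  have hset : ∀ s, MeasurableSet {z | τ z ≤ s} := fun s =>
    measurableSet_le hτ.measurable measurable_const
  have hint : ∀ s (f : ℝ → ℝ), Measurable f → (∃ B, ∀ z, |f z| ≤ B) →
      IntegrableOn (fun z => if τ z ≤ s then f z else 0) (Ioc 0 (u 1)) := by
    rintro s f hf ⟨B, hB⟩
    refine Integrable.of_bound (Measurable.ite (hset s) hf measurable_const).aestronglyMeasurable
      B (Filter.Eventually.of_forall fun z => ?_)
    rw [Real.norm_eq_abs]
    split_ifs
    · exact hB z
    · simpa using (abs_nonneg _).trans (hB z)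
  have hi1 : ∀ s, IntegrableOn (fun z => if τ z ≤ s then (1 : ℝ) else 0) (Ioc 0 (u 1)) :=
    fun s => hint s _ measurable_const ⟨1, by simp⟩
  have hiτ : ∀ s, IntegrableOn (fun z => if τ z ≤ s then τ z else 0) (Ioc 0 (u 1)) :=
    fun s => hint s _ hτ.measurable ⟨K, fun z => (abs_of_nonneg (hτ0 z)).le.trans (hτK z).2⟩
  have him : ∀ s, IntegrableOn (fun z => if τ z ≤ s then m z else 0) (Ioc 0 (u 1)) :=
    fun s => hint s _ hm.measurable
      ⟨K, fun z => (abs_of_nonneg (hmK z).1).le.trans (hmK z).2⟩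
  have hmono : ∀ f : ℝ → ℝ, (∀ z, 0 ≤ f z) → ∀ s s', s ≤ s' → ∀ z,
      (if τ z ≤ s then f z else 0) ≤ if τ z ≤ s' then f z else 0 := by
    intro f hf s s' h z
    split_ifs with h1 h2
    · exact le_rfl
    · exact absurd (h1.trans h) h2
    · exact hf z
    · exact le_rfl
  set P : ℝ → ℝ := fun s => ∫ z in Ioc 0 (u 1), (if τ z ≤ s then τ z else 0) with hP
  have hPmono : Monotone P := fun s s' h =>
    setIntegral_mono (hiτ s) (hiτ s') (hmono τ hτ0 s s' h)
  have hP0 : ∀ s, 0 ≤ P s := fun s => integral_nonneg fun z => by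
    simp only [Pi.zero_apply]
    split_ifs
    exacts [hτ0 z, le_rfl]
  have hXmono : Monotone fun a => X (min a A) := by
    intro a b h
    have hab : min a A ≤ min b A := min_le_min h le_rfl
    refine (humono.le_iff_le (hX01 _ (min_le_right _ _)) (hX01 _ (min_le_right _ _))).1 ?_
    rw [hXu _ (min_le_right _ _), hXu _ (min_le_right _ _)]
    exact setIntegral_mono (hi1 _) (hi1 _) (hmono _ (fun _ => zero_le_one) _ _ hab)
  have hPA : Monotone fun a => P (min a A) := fun a b h => hPmono (min_le_min h le_rfl)
  have hrent : ∀ a, ∀ s ≤ A, a * u (X s) - P s =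
      ∫ z in Ioc 0 (u 1), (if τ z ≤ s then a - τ z else 0) := by
    intro a s hs
    rw [hXu s hs, hP, ← integral_const_mul, ← integral_sub ((hi1 s).const_mul a) (hiτ s)]
    refine integral_congr_ae (Filter.Eventually.of_forall fun z => ?_)
    simp only
    split_ifs <;> simp
  have hirent : ∀ a s, IntegrableOn (fun z => if τ z ≤ s then a - τ z else 0) (Ioc 0 (u 1)) := by
    intro a s
    refine hint s _ (measurable_const.sub hτ.measurable) ⟨|a| + K, fun z => ?_⟩
    refine (abs_sub _ _).trans (add_le_add le_rfl ?_)
    exact (abs_of_nonneg (hτ0 z)).le.trans (hτK z).2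
  refine ⟨fun θ => X (min θ.1 A), fun θ => P (min θ.1 A), ⟨hXmono.measurable.comp measurable_fst,
    measurable_const, hPA.measurable.comp measurable_fst, ?_,
    fun θ _ => hX01 _ (min_le_right _ _), ?_, ?_⟩, ?_, ?_⟩
  · refine Integrable.of_bound (hPA.measurable.comp measurable_fst).aestronglyMeasurable (P A)
      (Filter.Eventually.of_forall fun θ => ?_)
    rw [Real.norm_of_nonneg (hP0 _)]
    exact hPmono (min_le_right _ _)
  · intro θ hθ θ' hθ'
    simp only [hc0, Pi.zero_apply, mul_zero, Finset.sum_const_zero, add_zero]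
    rw [hrent _ _ (min_le_right _ _), hrent _ _ (min_le_right _ _), min_eq_left (hA _ hθ.1)]
    refine setIntegral_mono (hirent _ _) (hirent _ _) fun z => ?_
    simp only
    split_ifs <;> linarith
  · intro θ hθ
    simp only [hc0, Pi.zero_apply, mul_zero, Finset.sum_const_zero, add_zero]
    rw [hrent _ _ (min_le_right _ _), min_eq_left (hA _ hθ.1)]
    refine integral_nonneg fun z => ?_
    simp only [Pi.zero_apply]
    split_ifs <;> linarith
  · intro θ θ' h
    simp only [h, and_self]
  · have hpt : ∀ a ∈ ΘA, -C (X (min a A)) + P (min a A) =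
        ∫ z in Ioc 0 (u 1), (if τ z ≤ a then τ z - m z else 0) := by
      intro a ha
      rw [hXC _ (min_le_right _ _), min_eq_left (hA a ha), neg_add_eq_sub,
        hP, ← integral_sub (hiτ a) (him a)]
      refine integral_congr_ae (Filter.Eventually.of_forall fun z => ?_)
      simp only
      split_ifs <;> simp
    have hmeas : AEStronglyMeasurable
        (fun a => ∫ z in Ioc 0 (u 1), (if τ z ≤ a then τ z - m z else 0)) γ.fst :=
      (integral_integral_posted γ.fst (g := fun z => τ z - m z) (hτ.measurable.sub hm.measurable)
        hτ.measurable (M := K) (fun z => by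
          rw [abs_of_nonneg (sub_nonneg.2 (hτK z).1)]
          linarith [(hτK z).2, (hmK z).1]) (u 1)).1.aestronglyMeasurable
    rw [Measure.fst] at hmeas ⊢
    rw [integral_map measurable_fst.aemeasurable hmeas]
    exact integral_congr_ae (hγ.mono fun θ hθ => hpt _ hθ)

/-- **Proposition 3 (marginal rates of substitution).** In the multiplicatively
separable monopoly pricing model with a non-interdependent, continuous,
nondecreasing cost function, if the marginal rates of substitution `r^B = θ^B/θ^A`
are stochastically nondecreasing in `θ^A`, then some optimal mechanism involves no
costly screening. -/
theorem stmt15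
    (y₀ : Y) (hy₀ : MeasurableSet ({y₀} : Set Y))
    (ΘA : Set ℝ) (ΘB : Set (Fin N → ℝ))
    (hΘA : IsCompact ΘA) (hΘApos : ∀ a ∈ ΘA, 0 < a)
    (hΘB : IsCompact ΘB) (hΘBnonpos : ∀ b ∈ ΘB, ∀ i, b i ≤ 0)
    (γ : Measure (ℝ × (Fin N → ℝ))) (hγp : IsProbabilityMeasure γ)
    (hγsupp : γ ((ΘA ×ˢ ΘB)ᶜ) = 0)
    (u : ℝ → ℝ) (huc : ContinuousOn u (Icc 0 1))
    (humono : StrictMonoOn u (Icc 0 1)) (hu0 : u 0 = 0)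
    (c : Y → (Fin N → ℝ)) (hcmeas : Measurable c)
    (hcbdd : ∃ M, ∀ y i, |c y i| ≤ M)
    (hcnonneg : ∀ y i, 0 ≤ c y i) (hc0 : c y₀ = 0)
    (C : ℝ → ℝ) (hCc : ContinuousOn C (Icc 0 1))
    (hCmono : MonotoneOn C (Icc 0 1)) (hC0 : C 0 = 0)
    -- r^B = θ^B/θ^A is stochastically nondecreasing in θ^A
    (hr : ∃ κ : Kernel ℝ (Fin N → ℝ),
      IsRCD (Measure.map
        (fun θ : ℝ × (Fin N → ℝ) => (θ.1, fun i => θ.2 i / θ.1)) γ) κ ∧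
      ∀ a ∈ MSupport γ.fst, ∀ a' ∈ MSupport γ.fst, a < a' →
        ∀ f : (Fin N → ℝ) → ℝ, Measurable f → Monotone f →
          (∃ M, ∀ b, |f b| ≤ M) →
          ∫ b, f b ∂(κ a) ≤ ∫ b, f b ∂(κ a')) :
    ∃ x y t, MechanismMS ΘA ΘB u c γ x y t ∧
      -- no costly screening
      (∀ θ, y θ = y₀) ∧
      (∀ θ θ' : ℝ × (Fin N → ℝ), θ.1 = θ'.1 → x θ = x θ' ∧ t θ = t θ') ∧
      -- optimality
      (∀ x' y' t', MechanismMS ΘA ΘB u c γ x' y' t' →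
        SellerPayoff C γ x' t' ≤ SellerPayoff C γ x t) := by
  have hu : ∀ x ∈ Icc (0 : ℝ) 1, u x ∈ Icc 0 (u 1) := fun x hx =>
    ⟨hu0 ▸ humono.monotoneOn ⟨le_rfl, zero_le_one⟩ hx hx.1,
      humono.monotoneOn hx ⟨zero_le_one, le_rfl⟩ hx.2⟩
  have hC : ∀ x ∈ Icc (0 : ℝ) 1, C x ∈ Icc 0 (C 1) := fun x hx =>
    ⟨hC0 ▸ hCmono ⟨le_rfl, zero_le_one⟩ hx hx.1, hCmono hx ⟨zero_le_one, le_rfl⟩ hx.2⟩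
  have hγ : ∀ᵐ θ ∂γ, θ ∈ ΘA ×ˢ ΘB := hγsupp
  obtain ⟨θ₀, hθ₀⟩ := hγ.exists
  obtain ⟨A, hA⟩ := hΘA.bddAbove
  have hA0 : 0 < A := (hΘApos _ hθ₀.1).trans_le (hA hθ₀.1)
  obtain ⟨m, τ, hm, hτ, hmK, hτK, hcost, hopt, hX⟩ :=
    exists_optimal_prices huc humono hu0 hCc hCmono hC0 γ.fst (K := A + 1) (by linarith)
  obtain ⟨x, t, hmech, hdep, hpay⟩ := exists_posted_mechanism (y₀ := y₀) ΘB γ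
    (hγ.mono fun θ hθ => hθ.1) humono hc0 (fun a ha => hA ha) hm hτ hmK hτK
    fun a ha => hX a (by linarith)
  obtain ⟨κ, hκ, hdom⟩ := hr
  refine ⟨x, fun _ => y₀, t, hmech, fun _ => rfl, hdep, fun x' y' t' h => ?_⟩
  obtain ⟨T, hT, U, q, k, hU, hq, hdown, hk0, hk, hTae, hint, hpay'⟩ :=
    h.exists_averaged_allocation hΘA hΘApos hΘBnonpos hγ huc hu hcmeas hcbdd hcnonneg hCc hC
      hκ hdom
  rw [hpay, hpay']
  refine integral_profit_le (hu 1 ⟨zero_le_one, le_rfl⟩).1 hm hτ hmK hτK hopt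
    (fun a ha => ⟨(hΘApos a (hT ha)).le, by linarith [hA (hT ha)]⟩) hU hq hdown hk0 ?_ hTae hint
  intro a ha q' hq'
  obtain ⟨s, hs, hsC⟩ := hcost q' hq'
  refine ⟨s, ?_⟩
  have := hk a ha s hs (-(s * q') + ∫ z in Ioc 0 q', m z) fun z hz => by linarith [hsC z hz]
  linarith
end
end

section
/- (Bundling and quality discrimination.) In the multiple-good monopoly model with probabilistic bundling and quality choice, if the ratio vector τ = (v^b / v^{b*})_{b ⊆ {1,…,G}} is stochastically nondecreasing in the grand-bundle value v^{b*}, then an optimal mechanism exists and can be implemented by a menu of prices for different qualities of the grand bundle: there is a mechanism attaining the supremum of the monopolist's expected revenue over all IC and IR measurable mechanisms in which α^{b*}(v) = 1 and α^b(v) = 0 for every proper bundle b, for all v, and which screens only via the quality q^{b*} of the grand bundle and the transfer. -/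
open MeasureTheory Set ProbabilityTheory

noncomputable section

variable {G : ℕ}

/-- A measurable IC and IR mechanism in the multiple-good monopoly model with
probabilistic bundling and quality discrimination. `S` is the (compact) support of
the value distribution `γ`. -/
def MechanismB (S : Set (Finset (Fin G) → ℝ))
    (γ : Measure (Finset (Fin G) → ℝ))
    (α q : (Finset (Fin G) → ℝ) → Finset (Fin G) → ℝ)
    (t : (Finset (Fin G) → ℝ) → ℝ) : Prop :=
  Measurable α ∧ Measurable q ∧ Measurable t ∧ Integrable t γ ∧
    (∀ v ∈ S, (∀ b, 0 ≤ α v b) ∧ (∑ b, α v b = 1) ∧ ∀ b, q v b ∈ Icc (0 : ℝ) 1) ∧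
    -- IC
    (∀ v ∈ S, ∀ v' ∈ S,
      (∑ b, α v b * q v b * v b) - t v ≥ (∑ b, α v' b * q v' b * v b) - t v') ∧
    -- IR
    (∀ v ∈ S, (∑ b, α v b * q v b * v b) - t v ≥ 0)

/-- The monopolist's expected payoff. -/
def MonopolyPayoff (C : ℝ → ℝ) (γ : Measure (Finset (Fin G) → ℝ))
    (α q : (Finset (Fin G) → ℝ) → Finset (Fin G) → ℝ)
    (t : (Finset (Fin G) → ℝ) → ℝ) : ℝ :=
  ∫ v, (-(∑ b, α v b * C (q v b)) + t v) ∂γ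

lemma rightDeriv_nonneg_of_monotoneOn {f : ℝ → ℝ} (hm : MonotoneOn f (Icc 0 1))
    (hv : ConvexOn ℝ (Icc 0 1) f) {s : ℝ} (hs : s ∈ Ioo (0 : ℝ) 1) :
    0 ≤ derivWithin f (Ioi s) s := by
  rw [hv.rightDeriv_eq_sInf_slope_of_mem_interior (by rwa [interior_Icc])]
  apply Real.sInf_nonneg
  rintro _ ⟨y, ⟨hy, hsy⟩, rfl⟩
  rw [slope_def_field]
  exact div_nonneg (sub_nonneg.2 (hm (Ioo_subset_Icc_self hs) hy hsy.le)) (sub_nonneg.2 hsy.le)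

lemma integrableOn_rightDeriv {f : ℝ → ℝ} (hc : ContinuousOn f (Icc 0 1))
    (hm : MonotoneOn f (Icc 0 1)) (hv : ConvexOn ℝ (Icc 0 1) f) :
    IntegrableOn (fun s => derivWithin f (Ioi s) s) (Ioo 0 1) := by
  rw [← integrableOn_Ioc_iff_integrableOn_Ioo]
  exact intervalIntegral.integrableOn_deriv_right_of_nonneg hc
    (fun x hx => hv.hasDerivWithinAt_rightDeriv_of_mem_interior (by rwa [interior_Icc]))
    (fun x hx => rightDeriv_nonneg_of_monotoneOn hm hv hx)

lemma setIntegral_rightDeriv {f : ℝ → ℝ} (hc : ContinuousOn f (Icc 0 1))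
    (hm : MonotoneOn f (Icc 0 1)) (hv : ConvexOn ℝ (Icc 0 1) f) {y : ℝ}
    (hy : y ∈ Icc (0 : ℝ) 1) :
    ∫ s in Ioo 0 y, derivWithin f (Ioi s) s = f y - f 0 := by
  rw [← integral_Ioc_eq_integral_Ioo, ← intervalIntegral.integral_of_le hy.1]
  refine intervalIntegral.integral_eq_sub_of_hasDeriv_right_of_le hy.1
    (hc.mono (Icc_subset_Icc_right hy.2))
    (fun x hx => hv.hasDerivWithinAt_rightDeriv_of_mem_interior
      (by rw [interior_Icc]; exact ⟨hx.1, hx.2.trans_le hy.2⟩)) ?_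
  rw [intervalIntegrable_iff_integrableOn_Ioo_of_le hy.1]
  exact (integrableOn_rightDeriv hc hm hv).mono_set (Ioo_subset_Ioo_right hy.2)

/-- The profit `(p - c)⁺ F[p, ∞)` attains its maximum over nonnegative prices, and the maximizer
can be taken to be either the choke price `M + 1` or a price with a positive margin and demand. -/
lemma exists_optimal_price (F : Measure ℝ) [IsProbabilityMeasure F] {M : ℝ} (hM : 0 ≤ M)
    (hF : ∀ᵐ x ∂F, x ≤ M) (c : ℝ) :
    ∃ p ∈ Icc 0 (M + 1), (p = M + 1 ∨ (c < p ∧ 0 < F.real (Ici p))) ∧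
      ∀ p', 0 ≤ p' → max (p' - c) 0 * F.real (Ici p') ≤ (p - c) * F.real (Ici p) := by
  have hzero : ∀ p, M < p → F.real (Ici p) = 0 := by
    intro p hp
    have : F (Ici p) = 0 := by
      refine measure_mono_null (fun x hx => ?_) (ae_iff.1 hF)
      exact not_le.2 (hp.trans_le hx)
    simp [Measure.real, this]
  have hanti : ∀ p p', p ≤ p' → F.real (Ici p') ≤ F.real (Ici p) := fun p p' h =>
    measureReal_mono (Ici_subset_Ici.2 h)
  have husc : UpperSemicontinuousOn (fun p => max (p - c) 0 * F.real (Ici p)) (Icc 0 (M + 1)) := by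
    intro p₀ _ y hy
    apply Filter.Eventually.filter_mono nhdsWithin_le_nhds
    have hlim : Filter.Tendsto (fun n : ℕ => F.real (Ici (p₀ - 1 / ((n : ℝ) + 1)))) Filter.atTop
        (nhds (F.real (Ici p₀))) := by
      have h1 : Filter.Tendsto (fun n : ℕ => F (Ici (p₀ - 1 / ((n : ℝ) + 1)))) Filter.atTop
          (nhds (F (⋂ n : ℕ, Ici (p₀ - 1 / ((n : ℝ) + 1))))) := by
        refine tendsto_measure_iInter_atTop (fun n => measurableSet_Ici.nullMeasurableSet) ?_
          ⟨0, measure_ne_top _ _⟩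
        intro m n hmn
        apply Ici_subset_Ici.2
        have := Nat.one_div_le_one_div (α := ℝ) hmn
        linarith
      have h2 : ⋂ n : ℕ, Ici (p₀ - 1 / ((n : ℝ) + 1)) = Ici p₀ := by
        ext x
        simp only [mem_iInter, mem_Ici]
        refine ⟨fun h => ?_, fun h n => ?_⟩
        · by_contra hx
          obtain ⟨n, hn⟩ := exists_nat_one_div_lt (sub_pos.2 (not_le.1 hx))
          linarith [h n]
        · have : 0 < 1 / ((n : ℝ) + 1) := Nat.one_div_pos_of_nat
          linarith
      rw [h2] at h1
      exact (ENNReal.tendsto_toReal (measure_ne_top _ _)).comp h1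
    have hev := (hlim.const_mul (max (p₀ - c) 0)).eventually (gt_mem_nhds hy)
    obtain ⟨n, hn⟩ := hev.exists
    have hcont : Continuous fun p => max (p - c) 0 * F.real (Ici (p₀ - 1 / ((n : ℝ) + 1))) := by
      fun_prop
    have hpos : 0 < 1 / ((n : ℝ) + 1) := Nat.one_div_pos_of_nat
    filter_upwards [hcont.continuousAt.eventually (gt_mem_nhds hn),
      lt_mem_nhds (show p₀ - 1 / ((n : ℝ) + 1) < p₀ by linarith)] with p hp1 hp2
    exact lt_of_le_of_lt (mul_le_mul_of_nonneg_left (hanti _ _ hp2.le) (le_max_right _ _)) hp1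
  obtain ⟨p, hp, hmax⟩ := husc.exists_isMaxOn ⟨0, by constructor <;> linarith⟩ isCompact_Icc
  have hmax' : ∀ p', 0 ≤ p' →
      max (p' - c) 0 * F.real (Ici p') ≤ max (p - c) 0 * F.real (Ici p) := by
    intro p' hp'
    by_cases h : p' ≤ M + 1
    · exact hmax ⟨hp', h⟩
    · rw [hzero p' (by linarith), mul_zero]
      exact mul_nonneg (le_max_right _ _) measureReal_nonneg
  by_cases hpos : 0 < max (p - c) 0 * F.real (Ici p)
  · have h1 : 0 < max (p - c) 0 := pos_of_mul_pos_left hpos measureReal_nonneg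
    have h2 : 0 < F.real (Ici p) := pos_of_mul_pos_right hpos h1.le
    have h3 : 0 < p - c := by simpa using h1
    rw [max_eq_left h3.le] at hmax'
    exact ⟨p, hp, Or.inr ⟨by linarith, h2⟩, hmax'⟩
  · refine ⟨M + 1, by constructor <;> linarith, Or.inl rfl, fun p' hp' => ?_⟩
    rw [hzero (M + 1) (by linarith), mul_zero]
    exact (hmax' p' hp').trans (not_lt.1 hpos)

/-- Optimal prices can be selected monotonically in the marginal cost. -/
lemma exists_monotone_optimal_price (F : Measure ℝ) [IsProbabilityMeasure F] {M : ℝ} (hM : 0 ≤ M)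
    (hF : ∀ᵐ x ∂F, x ≤ M) :
    ∃ p : ℝ → ℝ, Monotone p ∧ (∀ c, p c ∈ Icc 0 (M + 1)) ∧
      ∀ c p', 0 ≤ p' → max (p' - c) 0 * F.real (Ici p') ≤ (p c - c) * F.real (Ici (p c)) := by
  choose p hp hor hmax using exists_optimal_price F hM hF
  refine ⟨p, fun c c' hcc => ?_, hp, hmax⟩
  by_contra! hlt
  rcases hor c' with h | ⟨h1, h2⟩
  · linarith [(hp c).2]
  have hH : F.real (Ici (p c)) ≤ F.real (Ici (p c')) := measureReal_mono (Ici_subset_Ici.2 hlt.le)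
  have e1 := (mul_le_mul_of_nonneg_right (le_max_left _ 0) measureReal_nonneg).trans
    (hmax c (p c') (hp c').1)
  have e2 := (mul_le_mul_of_nonneg_right (le_max_left _ 0) measureReal_nonneg).trans
    (hmax c' (p c) (hp c).1)
  rcases hcc.eq_or_lt with rfl | hcc
  · exact lt_irrefl _ hlt
  have h3 : F.real (Ici (p c')) ≤ F.real (Ici (p c)) := by
    by_contra! h
    nlinarith [mul_pos (sub_pos.2 hcc) (sub_pos.2 h)]
  have h4 : F.real (Ici (p c)) = F.real (Ici (p c')) := le_antisymm hH h3
  rw [h4] at e2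
  nlinarith [mul_pos (sub_pos.2 hlt) h2]

lemma integrable_threshold (F lam : Measure ℝ) [IsProbabilityMeasure F] [SFinite lam]
    {a b : ℝ → ℝ} (ha : Measurable a) (hb : Integrable b lam) :
    Integrable (fun z : ℝ × ℝ => (Ici (a z.2)).indicator (fun _ => b z.2) z.1) (F.prod lam) := by
  have h := (hb.comp_snd F).indicator
    (measurableSet_le (ha.comp measurable_snd) (measurable_fst (α := ℝ) (β := ℝ)))
  exact h

lemma integral_indicator_Ici (F : Measure ℝ) (a b : ℝ) :
    ∫ x, (Ici a).indicator (fun _ => b) x ∂F = b * F.real (Ici a) := by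
  rw [integral_indicator_const _ measurableSet_Ici, smul_eq_mul, mul_comm]

lemma integral_threshold (F lam : Measure ℝ) [IsProbabilityMeasure F] [SFinite lam]
    {a b : ℝ → ℝ} (ha : Measurable a) (hb : Integrable b lam) :
    ∫ x, ∫ s, (Ici (a s)).indicator (fun _ => b s) x ∂lam ∂F
      = ∫ s, b s * F.real (Ici (a s)) ∂lam := by
  rw [integral_integral_swap (integrable_threshold F lam ha hb)]
  simp_rw [integral_indicator_Ici]

lemma integrable_mul_real_Ici (F lam : Measure ℝ) [IsProbabilityMeasure F] [SFinite lam]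
    {a b : ℝ → ℝ} (ha : Measurable a) (hb : Integrable b lam) :
    Integrable (fun s => b s * F.real (Ici (a s))) lam := by
  have h := (integrable_threshold F lam ha hb).integral_prod_right
  simpa only [integral_indicator_Ici] using h

/-- Selling the quality increment `s` at unit price `p s` gives an incentive compatible quality
menu whose profit is the total profit from the increments. -/
lemma exists_menu_of_prices (F : Measure ℝ) [IsProbabilityMeasure F] {C : ℝ → ℝ}
    (hCc : ContinuousOn C (Icc 0 1)) (hCm : MonotoneOn C (Icc 0 1))
    (hCv : ConvexOn ℝ (Icc 0 1) C) (hC0 : C 0 = 0) {N : ℝ} {p : ℝ → ℝ} (hp : Measurable p)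
    (hpm : MonotoneOn p (Ioo 0 1)) (hpN : ∀ s, p s ∈ Icc 0 N) :
    ∃ Q u : ℝ → ℝ, Monotone Q ∧ Monotone u ∧ (∀ x, Q x ∈ Icc (0 : ℝ) 1) ∧ (∀ x, 0 ≤ u x) ∧
      (∀ x y, u x + Q x * (y - x) ≤ u y) ∧
      ∫ x, (-C (Q x) + (x * Q x - u x)) ∂F
        = ∫ s in Ioo 0 1, (p s - derivWithin C (Ioi s) s) * F.real (Ici (p s)) := by
  set lam : Measure ℝ := volume.restrict (Ioo 0 1) with hlam
  have hlam1 : IsProbabilityMeasure lam := ⟨by simp [hlam]⟩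
  have hint : ∀ x, Integrable (fun s => max (x - p s) 0) lam := fun x => by
    refine Integrable.of_bound (C := |x| + N) (by fun_prop) (ae_of_all _ fun s => ?_)
    rw [Real.norm_eq_abs, abs_of_nonneg (le_max_right _ _)]
    have := hpN s
    exact max_le (by linarith [le_abs_self x, this.1, this.2])
      (by linarith [abs_nonneg x, this.1, this.2])
  have hms : ∀ x, MeasurableSet {s | p s ≤ x} := fun x => measurableSet_le hp measurable_const
  have hstep : ∀ x y, (∫ s, max (x - p s) 0 ∂lam) + lam.real {s | p s ≤ x} * (y - x)
      ≤ ∫ s, max (y - p s) 0 ∂lam := fun x y => by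
    rw [← smul_eq_mul, ← integral_indicator_const _ (hms x), ← integral_add (hint x)
      ((integrable_const _).indicator (hms x))]
    refine integral_mono ((hint x).add ((integrable_const _).indicator (hms x))) (hint y)
      fun s => ?_
    by_cases h : p s ≤ x
    · simp only [mem_ofPred_eq, h, indicator_of_mem]
      rw [max_eq_left (by linarith)]
      exact le_trans (by linarith) (le_max_left _ _)
    · simp only [mem_ofPred_eq, h, not_false_eq_true, indicator_of_notMem, add_zero]
      rw [max_eq_right (by linarith)]
      exact le_max_right _ _
  have hc := integrableOn_rightDeriv hCc hCm hCv
  have hpint : Integrable p lam :=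
    Integrable.of_bound (C := N) hp.aestronglyMeasurable (ae_of_all _ fun s => by
      rw [Real.norm_eq_abs, abs_of_nonneg (hpN s).1]; exact (hpN s).2)
  refine ⟨fun x => lam.real {s | p s ≤ x}, fun x => ∫ s, max (x - p s) 0 ∂lam, ?_, ?_, ?_, ?_,
    hstep, ?_⟩
  · intro x y hxy
    exact measureReal_mono fun s (hs : p s ≤ x) => hs.trans hxy
  · intro x y hxy
    exact integral_mono (hint x) (hint y) fun s => max_le_max (by linarith) le_rfl
  · exact fun x => ⟨measureReal_nonneg, measureReal_le_one⟩
  · exact fun x => integral_nonneg fun s => le_max_right _ _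
  refine Eq.trans ?_ (integral_threshold F lam hp (hpint.sub hc))
  congr 1 with x
  beta_reduce
  set q := lam.real {s | p s ≤ x} with hq
  have hq01 : q ∈ Icc (0 : ℝ) 1 := ⟨measureReal_nonneg, measureReal_le_one⟩
  have hsub : {s | p s ≤ x} ∩ Ioo 0 1 ⊆ Ioc 0 q := by
    rintro s ⟨hs, hs01⟩
    refine ⟨hs01.1, ?_⟩
    have h1 : Ioc 0 s ⊆ {s | p s ≤ x} := fun r hr =>
      (hpm ⟨hr.1, hr.2.trans_lt hs01.2⟩ hs01 hr.2).trans hs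
    have h2 : lam.real (Ioc 0 s) = s := by
      rw [hlam, measureReal_restrict_apply measurableSet_Ioc,
        (inter_eq_left (s := Ioc 0 s) (t := Ioo 0 1)).2 fun r hr => ⟨hr.1, hr.2.trans_lt hs01.2⟩]
      simp [hs01.1.le]
    exact h2 ▸ measureReal_mono h1
  have hae : ({s | p s ≤ x} ∩ Ioo 0 1 : Set ℝ) =ᵐ[volume] Ioc 0 q := by
    refine ae_eq_of_subset_of_measure_ge hsub ?_
      ((hms x).inter measurableSet_Ioo).nullMeasurableSet (by simp)
    rw [← Measure.restrict_apply (hms x), Real.volume_Ioc, sub_zero, hq, ofReal_measureReal]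
  have hcost : ∫ s, {s | p s ≤ x}.indicator (fun s => derivWithin C (Ioi s) s) s ∂lam = C q := by
    rw [integral_indicator (hms x), hlam, Measure.restrict_restrict (hms x),
      setIntegral_congr_set hae, integral_Ioc_eq_integral_Ioo, setIntegral_rightDeriv hCc hCm hCv hq01,
      hC0, sub_zero]
  have hrev : x * q - ∫ s, max (x - p s) 0 ∂lam = ∫ s, {s | p s ≤ x}.indicator p s ∂lam := by
    rw [mul_comm, ← smul_eq_mul, hq, ← integral_indicator_const _ (hms x), ← integral_sub
      ((integrable_const _).indicator (hms x)) (hint x)]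
    congr 1 with s
    by_cases h : p s ≤ x
    · simp [h]
    · simp [h, (not_le.1 h).le]
  rw [hrev, ← hcost, neg_add_eq_sub, ← integral_sub (hpint.indicator (hms x))
    (Integrable.indicator hc (hms x))]
  congr 1 with s
  by_cases h : p s ≤ x <;> simp [h]

/-- The conjugate of the indirect utility of a mechanism satisfying only the downward incentive
constraints is a convex tariff at which buying less than the assigned quality is unattractive. -/
lemma exists_convex_tariff {M : ℝ} {X : Set ℝ} (hX : ∀ x ∈ X, 0 < x ∧ x ≤ M) (hne : X.Nonempty)
    {Q u : ℝ → ℝ} (hu : ∀ x ∈ X, 0 ≤ u x)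
    (hIC : ∀ x ∈ X, ∀ y ∈ X, x < y → u x + Q x * (y - x) ≤ u y) :
    ∃ T : ℝ → ℝ, ContinuousOn T (Icc 0 1) ∧ MonotoneOn T (Icc 0 1) ∧ ConvexOn ℝ (Icc 0 1) T ∧
      T 0 ≤ 0 ∧ (∀ x ∈ X, ∀ q, 0 ≤ q → x * q - u x ≤ T q) ∧
      ∀ x ∈ X, ∀ q ∈ Icc 0 (Q x), T (Q x) - T q ≤ x * (Q x - q) := by
  have := hne.to_subtype
  have hbdd : ∀ q, 0 ≤ q → BddAbove (range fun z : X => (z : ℝ) * q - u z) := by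
    rintro q hq
    refine ⟨M * q, ?_⟩
    rintro _ ⟨⟨z, hz⟩, rfl⟩
    have := mul_le_mul_of_nonneg_right (hX z hz).2 hq
    have := hu z hz
    dsimp only
    linarith
  set T : ℝ → ℝ := fun q => ⨆ z : X, ((z : ℝ) * q - u z) with hT
  have hle : ∀ x ∈ X, ∀ q, 0 ≤ q → x * q - u x ≤ T q := fun x hx q hq =>
    le_ciSup (hbdd q hq) ⟨x, hx⟩
  have hmono : ∀ q q', 0 ≤ q → q ≤ q' → T q ≤ T q' := fun q q' hq hqq =>
    ciSup_le fun ⟨z, hz⟩ => le_trans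
      (by have := mul_le_mul_of_nonneg_left hqq (hX z hz).1.le; dsimp only; linarith)
      (hle z hz q' (hq.trans hqq))
  have hstep : ∀ q q', 0 ≤ q → q ≤ q' → T q' ≤ T q + M * (q' - q) := fun q q' hq hqq =>
    ciSup_le fun ⟨z, hz⟩ => by
      have h1 := hle z hz q hq
      have h2 := mul_le_mul_of_nonneg_right (hX z hz).2 (sub_nonneg.2 hqq)
      dsimp only
      linarith
  have hM : 0 ≤ M := by
    obtain ⟨x, hx⟩ := hne
    linarith [hX x hx]
  refine ⟨T, ?_, fun q hq q' _ => hmono q q' hq.1, ⟨convex_Icc _ _, ?_⟩, ?_, hle, ?_⟩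
  · refine (LipschitzOnWith.of_le_add_mul' M fun q hq q' hq' => ?_).continuousOn
    rcases le_total q q' with h | h
    · exact (hmono q q' hq.1 h).trans (le_add_of_nonneg_right (mul_nonneg hM dist_nonneg))
    · rw [Real.dist_eq, abs_of_nonneg (sub_nonneg.2 h)]
      exact hstep q' q hq'.1 h
  · intro q hq q' hq' a b ha hb hab
    refine ciSup_le fun ⟨z, hz⟩ => ?_
    have h1 := mul_le_mul_of_nonneg_left (hle z hz q hq.1) ha
    have h2 := mul_le_mul_of_nonneg_left (hle z hz q' hq'.1) hb
    simp only [smul_eq_mul]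
    have h3 : u z = a * u z + b * u z := by rw [← add_mul, hab, one_mul]
    rw [h3]
    linarith
  · refine ciSup_le fun ⟨z, hz⟩ => ?_
    have := hu z hz
    simpa using this
  · intro x hx q hq
    suffices h : T (Q x) ≤ T q + x * (Q x - q) by linarith
    refine ciSup_le fun ⟨z, hz⟩ => ?_
    dsimp only
    rcases lt_or_ge x z with h | h
    · have h1 := hIC x hx z hz h
      have h2 := hle x hx q hq.1
      linarith
    · have h1 := hle z hz q hq.1
      have h2 := mul_le_mul_of_nonneg_right h (sub_nonneg.2 hq.2)
      linarith

/-- The payoff from a single-good mechanism that satisfies only the downward incentive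
constraints is at most the sum over quality increments of the optimal posted-price profits. -/
lemma integral_payoff_le_of_downward_IC (F : Measure ℝ) [IsProbabilityMeasure F] {C : ℝ → ℝ}
    (hCc : ContinuousOn C (Icc 0 1)) (hCm : MonotoneOn C (Icc 0 1))
    (hCv : ConvexOn ℝ (Icc 0 1) C) (hC0 : C 0 = 0) {N : ℝ} {p : ℝ → ℝ} (hp : Measurable p)
    (hpN : ∀ s, p s ∈ Icc 0 N)
    (hopt : ∀ s, ∀ r, 0 ≤ r → max (r - derivWithin C (Ioi s) s) 0 * F.real (Ici r)
      ≤ (p s - derivWithin C (Ioi s) s) * F.real (Ici (p s)))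
    {M : ℝ} {X : Set ℝ} (hX : ∀ x ∈ X, 0 < x ∧ x ≤ M) (hFX : ∀ᵐ x ∂F, x ∈ X)
    {Q u A : ℝ → ℝ} (hQ : ∀ x ∈ X, Q x ∈ Icc (0 : ℝ) 1) (hu : ∀ x ∈ X, 0 ≤ u x)
    (hIC : ∀ x ∈ X, ∀ y ∈ X, x < y → u x + Q x * (y - x) ≤ u y)
    (hA : Integrable A F) (hAle : ∀ x ∈ X, A x ≤ x * Q x - C (Q x) - u x) :
    ∫ x, A x ∂F ≤
      ∫ s in Ioo 0 1, (p s - derivWithin C (Ioi s) s) * F.real (Ici (p s)) := by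
  obtain ⟨T, hTc, hTm, hTv, hT0, hTu, hTQ⟩ := exists_convex_tariff hX hFX.exists hu hIC
  set lam : Measure ℝ := volume.restrict (Ioo 0 1) with hlam
  have hlam1 : IsProbabilityMeasure lam := ⟨by simp [hlam]⟩
  set c : ℝ → ℝ := fun s => derivWithin C (Ioi s) s with hcdef
  set T' : ℝ → ℝ := fun s => derivWithin T (Ioi s) s with hT'def
  have hTmeas : Measurable T' := measurable_derivWithin_Ioi T
  have hc : Integrable c lam := integrableOn_rightDeriv hCc hCm hCv
  have hT' : Integrable T' lam := integrableOn_rightDeriv hTc hTm hTv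
  have hpint : Integrable p lam :=
    Integrable.of_bound (C := N) hp.aestronglyMeasurable (ae_of_all _ fun s => by
      rw [Real.norm_eq_abs, abs_of_nonneg (hpN s).1]; exact (hpN s).2)
  have hb : Integrable (fun s => max (T' s - c s) 0) lam := (hT'.sub hc).pos_part
  have hthr := integrable_threshold F lam hTmeas hb
  calc ∫ x, A x ∂F
      ≤ ∫ x, ∫ s, (Ici (T' s)).indicator (fun _ => max (T' s - c s) 0) x ∂lam ∂F := by
        refine integral_mono_ae hA hthr.integral_prod_left ?_
        filter_upwards [hFX, hthr.prod_right_ae] with x hx hxint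
        have hq := hQ x hx
        have hIoo : Ioo 0 (Q x) ⊆ Ioo (0 : ℝ) 1 := Ioo_subset_Ioo_right hq.2
        have h1 : A x ≤ ∫ s in Ioo 0 (Q x), (T' s - c s) := by
          rw [integral_sub (IntegrableOn.mono_set hT' hIoo) (IntegrableOn.mono_set hc hIoo)]
          simp only [hT'def, hcdef]
          rw [setIntegral_rightDeriv hTc hTm hTv hq, setIntegral_rightDeriv hCc hCm hCv hq, hC0]
          linarith [hAle x hx, hTu x hx (Q x) hq.1]
        refine h1.trans ?_
        have h2 : ∫ s in Ioo 0 (Q x), (T' s - c s) ≤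
            ∫ s in Ioo 0 (Q x), (Ici (T' s)).indicator (fun _ => max (T' s - c s) 0) x := by
          refine setIntegral_mono_on (IntegrableOn.mono_set (hT'.sub hc) hIoo)
            (IntegrableOn.mono_set hxint hIoo) measurableSet_Ioo fun s hs => ?_
          have hs1 : T' s ≤ x := by
            have h3 := hTv.rightDeriv_le_slope_of_mem_interior (x := s) (y := Q x)
              (by rw [interior_Icc]; exact hIoo hs) hq hs.2
            refine h3.trans ?_
            rw [slope_def_field, div_le_iff₀ (sub_pos.2 hs.2)]
            exact hTQ x hx s ⟨hs.1.le, hs.2.le⟩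
          rw [indicator_of_mem (mem_Ici.2 hs1)]
          exact le_max_left _ _
        refine h2.trans (setIntegral_mono_set hxint ?_ hIoo.eventuallyLE)
        exact ae_of_all _ fun s => indicator_nonneg (fun _ _ => le_max_right _ _) _
    _ = ∫ s, max (T' s - c s) 0 * F.real (Ici (T' s)) ∂lam := integral_threshold F lam hTmeas hb
    _ ≤ ∫ s, (p s - c s) * F.real (Ici (p s)) ∂lam := by
        refine integral_mono_ae (integrable_mul_real_Ici F lam hTmeas hb)
          (integrable_mul_real_Ici F lam hp (hpint.sub hc)) ?_
        filter_upwards [ae_restrict_mem measurableSet_Ioo] with s hs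
        exact hopt s _ (rightDeriv_nonneg_of_monotoneOn hTm hTv hs)

lemma IsRCD.eq_compProd {A B : Type*} [MeasurableSpace A] [MeasurableSpace B]
    {ρ : Measure (A × B)} [IsFiniteMeasure ρ] {κ : Kernel A B} (h : IsRCD ρ κ) :
    ρ = ρ.fst ⊗ₘ κ := by
  have := h.1
  ext s hs
  rw [Measure.compProd_apply hs, h.2 s hs]
  rfl

lemma ae_mem_MSupport (F : Measure ℝ) : ∀ᵐ x ∂F, x ∈ MSupport F := by
  filter_upwards [Measure.support_mem_ae (μ := F)] with x hx
  rw [Measure.support_eq_forall_isOpen] at hx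
  exact fun U hU hxU => hx U hxU hU

/-- Averaging a bundling mechanism over the ratio vector, conditionally on the grand-bundle value,
gives a single-good mechanism that satisfies the downward incentive constraints and whose payoff
is at least as large. -/
lemma exists_averaged_mechanism
    {S : Set (Finset (Fin G) → ℝ)} (hS : MeasurableSet S) {M : ℝ}
    (hSval : ∀ v ∈ S, v ∅ = 0 ∧ (∀ b b' : Finset (Fin G), b ⊆ b' → v b ≤ v b') ∧
      0 < v Finset.univ) (hM : ∀ v ∈ S, v Finset.univ ≤ M)
    {γ : Measure (Finset (Fin G) → ℝ)} [IsProbabilityMeasure γ] (hγ : ∀ᵐ v ∂γ, v ∈ S)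
    {C : ℝ → ℝ} (hCc : Continuous C) (hCm : MonotoneOn C (Icc 0 1))
    (hCv : ConvexOn ℝ (Icc 0 1) C) (hC0 : C 0 = 0)
    {κ : Kernel ℝ (Finset (Fin G) → ℝ)}
    (hκ : IsRCD (Measure.map
        (fun v : Finset (Fin G) → ℝ =>
          (v Finset.univ, fun b => v b / v Finset.univ)) γ) κ)
    (hdom : ∀ a ∈ MSupport (Measure.map
          (fun v : Finset (Fin G) → ℝ => v Finset.univ) γ),
        ∀ a' ∈ MSupport (Measure.map
          (fun v : Finset (Fin G) → ℝ => v Finset.univ) γ), a < a' →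
        ∀ f : (Finset (Fin G) → ℝ) → ℝ, Measurable f → Monotone f →
          (∃ M, ∀ w, |f w| ≤ M) →
          ∫ w, f w ∂(κ a) ≤ ∫ w, f w ∂(κ a'))
    {α q : (Finset (Fin G) → ℝ) → Finset (Fin G) → ℝ} {t : (Finset (Fin G) → ℝ) → ℝ}
    (hmech : MechanismB S γ α q t) :
    ∃ (X : Set ℝ) (Q u A : ℝ → ℝ), (∀ x ∈ X, 0 < x ∧ x ≤ M) ∧
      (∀ᵐ x ∂(γ.map fun v : Finset (Fin G) → ℝ => v Finset.univ), x ∈ X) ∧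
      (∀ x ∈ X, Q x ∈ Icc (0 : ℝ) 1) ∧ (∀ x ∈ X, 0 ≤ u x) ∧
      (∀ x ∈ X, ∀ y ∈ X, x < y → u x + Q x * (y - x) ≤ u y) ∧
      Integrable A (γ.map fun v : Finset (Fin G) → ℝ => v Finset.univ) ∧
      (∀ x ∈ X, A x ≤ x * Q x - C (Q x) - u x) ∧
      MonopolyPayoff C γ α q t = ∫ x, A x ∂(γ.map fun v : Finset (Fin G) → ℝ => v Finset.univ) := by
  obtain ⟨hαm, hqm, htm, -, hfeas, hIC, hIR⟩ := hmech
  have hκ1 := hκ.1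
  have hφm : Measurable fun v : Finset (Fin G) → ℝ =>
      (v Finset.univ, fun b => v b / v Finset.univ) := by fun_prop
  set F := γ.map fun v : Finset (Fin G) → ℝ => v Finset.univ with hF
  have hF1 : IsProbabilityMeasure F :=
    Measure.isProbabilityMeasure_map (measurable_pi_apply _).aemeasurable
  set ρ := γ.map fun v : Finset (Fin G) → ℝ =>
    (v Finset.univ, fun b => v b / v Finset.univ) with hρ
  have hρ1 : IsProbabilityMeasure ρ := Measure.isProbabilityMeasure_map hφm.aemeasurable
  have hfst : ρ.fst = F := Measure.fst_map_prodMk (by fun_prop)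
  have hcomp : ρ = F ⊗ₘ κ := by rw [← hfst]; exact hκ.eq_compProd
  have hscale : ∀ v ∈ S, (v Finset.univ • (fun b => v b / v Finset.univ) :
      Finset (Fin G) → ℝ) = v := fun v hv => by
    ext b
    exact mul_div_cancel₀ _ (hSval v hv).2.2.ne'
  -- elementary bounds on the mechanism
  set w : (Finset (Fin G) → ℝ) → Finset (Fin G) → ℝ := fun v b => α v b * q v b with hw
  have hwm : ∀ b, Measurable fun v => w v b := fun b => by
    simp only [hw]
    exact ((measurable_pi_apply b).comp hαm).mul ((measurable_pi_apply b).comp hqm)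
  have hw0 : ∀ v ∈ S, ∀ b, 0 ≤ w v b := fun v hv b =>
    mul_nonneg ((hfeas v hv).1 b) ((hfeas v hv).2.2 b).1
  have hw1 : ∀ v ∈ S, ∑ b, w v b ≤ 1 := fun v hv => by
    rw [← (hfeas v hv).2.1]
    exact Finset.sum_le_sum fun b _ =>
      mul_le_of_le_one_right ((hfeas v hv).1 b) ((hfeas v hv).2.2 b).2
  have hwle1 : ∀ v ∈ S, ∀ b, w v b ≤ 1 := fun v hv b =>
    (Finset.single_le_sum (fun b _ => hw0 v hv b) (Finset.mem_univ b)).trans (hw1 v hv)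
  have hv0 : ∀ v ∈ S, ∀ b, 0 ≤ v b := fun v hv b =>
    (hSval v hv).1 ▸ (hSval v hv).2.1 ∅ b (Finset.empty_subset b)
  have hvle : ∀ v ∈ S, ∀ b, v b ≤ v Finset.univ := fun v hv b =>
    (hSval v hv).2.1 b _ (Finset.subset_univ b)
  obtain ⟨v₀, hv₀⟩ : S.Nonempty := hγ.exists
  have hM0 : 0 ≤ M := (hSval v₀ hv₀).2.2.le.trans (hM v₀ hv₀)
  have hsum_nonneg : ∀ v ∈ S, ∀ y : Finset (Fin G) → ℝ, (∀ b, 0 ≤ y b) →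
      0 ≤ ∑ b, w v b * y b := fun v hv y hy =>
    Finset.sum_nonneg fun b _ => mul_nonneg (hw0 v hv b) (hy b)
  have hsum_le : ∀ v ∈ S, ∀ y : Finset (Fin G) → ℝ, ∀ m, 0 ≤ m → (∀ b, y b ≤ m) →
      ∑ b, w v b * y b ≤ m := fun v hv y m hm hy => by
    calc ∑ b, w v b * y b ≤ ∑ b, w v b * m :=
          Finset.sum_le_sum fun b _ => mul_le_mul_of_nonneg_left (hy b) (hw0 v hv b)
      _ = (∑ b, w v b) * m := by rw [Finset.sum_mul]
      _ ≤ m := mul_le_of_le_one_left hm (hw1 v hv)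
  obtain ⟨K, hK⟩ : ∃ K, ∀ v ∈ S, |t v| ≤ K := by
    refine ⟨M + |t v₀|, fun v hv => abs_le.2 ⟨?_, ?_⟩⟩
    · have h1 := hIC v₀ hv₀ v hv
      have h2 := hsum_le v₀ hv₀ v₀ M hM0 fun b => (hvle v₀ hv₀ b).trans (hM v₀ hv₀)
      have h3 := hsum_nonneg v hv v₀ (hv0 v₀ hv₀)
      have h4 := neg_abs_le (t v₀)
      simp only [hw] at h2 h3
      linarith
    · have h1 := hIR v hv
      have h2 := hsum_le v hv v M hM0 fun b => (hvle v hv b).trans (hM v hv)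
      have h4 := abs_nonneg (t v₀)
      simp only [hw] at h2
      linarith
  -- the indirect utility
  have : Nonempty S := ⟨⟨v₀, hv₀⟩⟩
  set U : (Finset (Fin G) → ℝ) → ℝ := fun y => ⨆ v : S, (∑ b, w v b * y b - t v) with hU
  have hbdd : ∀ y : Finset (Fin G) → ℝ, BddAbove (range fun v : S => ∑ b, w v b * y b - t v) := by
    refine fun y => ⟨(∑ b, |y b|) + K, ?_⟩
    rintro _ ⟨⟨v, hv⟩, rfl⟩
    have h1 : ∑ b, w v b * y b ≤ ∑ b, |y b| := Finset.sum_le_sum fun b _ =>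
      (mul_le_mul_of_nonneg_left (le_abs_self _) (hw0 v hv b)).trans
        (mul_le_of_le_one_left (abs_nonneg _) (hwle1 v hv b))
    have h2 := (abs_le.1 (hK v hv)).1
    dsimp only
    linarith
  have hUle : ∀ v ∈ S, ∀ y, ∑ b, w v b * y b - t v ≤ U y := fun v hv y =>
    le_ciSup (hbdd y) ⟨v, hv⟩
  have hUeq : ∀ v ∈ S, U v = ∑ b, w v b * v b - t v := fun v hv =>
    le_antisymm (ciSup_le fun ⟨v', hv'⟩ => hIC v hv v' hv') (hUle v hv v)
  have hUmono : Monotone U := fun y y' hyy => ciSup_le fun ⟨v, hv⟩ =>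
    (sub_le_sub_right (Finset.sum_le_sum fun b _ =>
      mul_le_mul_of_nonneg_left (hyy b) (hw0 v hv b)) _).trans (hUle v hv y')
  have hUmeas : Measurable U := by
    apply LowerSemicontinuous.measurable
    refine lowerSemicontinuous_ciSup hbdd fun v => Continuous.lowerSemicontinuous ?_
    fun_prop
  -- conditional distributions live on rescaled types
  have hae : ∀ᵐ x ∂F, ∀ᵐ τ ∂κ x, (x • τ : Finset (Fin G) → ℝ) ∈ S ∧ τ Finset.univ = 1 := by
    have h1 : ∀ᵐ z ∂ρ, (z.1 • z.2 : Finset (Fin G) → ℝ) ∈ S ∧ z.2 Finset.univ = 1 := by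
      rw [hρ, ae_map_iff hφm.aemeasurable]
      · filter_upwards [hγ] with v hv
        rw [hscale v hv]
        exact ⟨hv, div_self (hSval v hv).2.2.ne'⟩
      · exact ((measurable_fst.smul measurable_snd) hS).inter
          (measurableSet_eq_fun (by fun_prop) (by fun_prop))
    rw [hcomp] at h1
    exact Measure.ae_ae_of_ae_compProd h1
  set X : Set ℝ := {x | x ∈ MSupport F ∧
    ∀ᵐ τ ∂κ x, (x • τ : Finset (Fin G) → ℝ) ∈ S ∧ τ Finset.univ = 1} with hXdef
  have hX : ∀ x ∈ X, 0 < x ∧ x ≤ M := fun x hx => by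
    obtain ⟨τ, h1, h2⟩ := hx.2.exists
    have h3 := (hSval _ h1).2.2
    have h4 := hM _ h1
    simp only [Pi.smul_apply, smul_eq_mul, h2, mul_one] at h3 h4
    exact ⟨h3, h4⟩
  have hτ01 : ∀ x ∈ X, ∀ τ : Finset (Fin G) → ℝ, (x • τ : Finset (Fin G) → ℝ) ∈ S →
      τ Finset.univ = 1 → ∀ b, 0 ≤ τ b ∧ τ b ≤ 1 := fun x hx τ h1 h2 b => by
    have h3 := hv0 _ h1 b
    have h4 := hvle _ h1 b
    simp only [Pi.smul_apply, smul_eq_mul, h2] at h3 h4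
    exact ⟨nonneg_of_mul_nonneg_right h3 (hX x hx).1, le_of_mul_le_mul_left h4 (hX x hx).1⟩
  have hsm : ∀ x : ℝ, Measurable fun τ : Finset (Fin G) → ℝ => (x • τ : Finset (Fin G) → ℝ) :=
    fun x => by fun_prop
  set r : ℝ → (Finset (Fin G) → ℝ) → ℝ := fun x τ => ∑ b, w (x • τ) b * τ b with hr
  have hrm : ∀ x, Measurable (r x) := fun x => by
    refine Finset.measurable_sum _ fun b _ => ?_
    exact ((hwm b).comp (hsm x)).mul (measurable_pi_apply b)
  have hr01 : ∀ x ∈ X, ∀ᵐ τ ∂κ x, r x τ ∈ Icc (0 : ℝ) 1 := fun x hx => by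
    filter_upwards [hx.2] with τ ⟨h1, h2⟩
    exact ⟨hsum_nonneg _ h1 τ fun b => (hτ01 x hx τ h1 h2 b).1,
      hsum_le _ h1 τ 1 zero_le_one fun b => (hτ01 x hx τ h1 h2 b).2⟩
  have hrint : ∀ x ∈ X, Integrable (r x) (κ x) := fun x hx => by
    refine Integrable.of_bound (C := 1) (hrm x).aestronglyMeasurable ?_
    filter_upwards [hr01 x hx] with τ hτ
    rw [Real.norm_eq_abs, abs_of_nonneg hτ.1]
    exact hτ.2
  have hsm_mono : ∀ x : ℝ, 0 ≤ x → ∀ τ τ' : Finset (Fin G) → ℝ, τ ≤ τ' → U (x • τ) ≤ U (x • τ') :=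
    fun x hx τ τ' h => hUmono (smul_le_smul_of_nonneg_left h hx)
  have hUint : ∀ x ∈ X, ∀ y : ℝ, 0 ≤ y → Integrable (fun τ => U (y • τ)) (κ x) := fun x hx y hy => by
    refine Integrable.of_mem_Icc (U (y • 0)) (U (y • 1))
      (hUmeas.comp (hsm y)).aemeasurable ?_
    filter_upwards [hx.2] with τ ⟨h1, h2⟩
    exact ⟨hsm_mono y hy _ _ fun b => (hτ01 x hx τ h1 h2 b).1,
      hsm_mono y hy _ _ fun b => (hτ01 x hx τ h1 h2 b).2⟩
  set pay : (Finset (Fin G) → ℝ) → ℝ := fun v => -(∑ b, α v b * C (q v b)) + t v with hpay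
  have hpaym : Measurable pay := by
    refine (Finset.measurable_sum _ fun b _ => ?_).neg.add htm
    exact ((measurable_pi_apply b).comp hαm).mul
      (hCc.measurable.comp ((measurable_pi_apply b).comp hqm))
  have hCpos : ∀ z ∈ Icc (0 : ℝ) 1, 0 ≤ C z ∧ C z ≤ C 1 := fun z hz =>
    ⟨hC0 ▸ hCm (left_mem_Icc.2 zero_le_one) hz hz.1, hCm hz (right_mem_Icc.2 zero_le_one) hz.2⟩
  have hpayb : ∀ v ∈ S, ‖pay v‖ ≤ C 1 + K := fun v hv => by
    have h1 : 0 ≤ ∑ b, α v b * C (q v b) := Finset.sum_nonneg fun b _ =>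
      mul_nonneg ((hfeas v hv).1 b) (hCpos _ ((hfeas v hv).2.2 b)).1
    have h2 : ∑ b, α v b * C (q v b) ≤ C 1 := by
      calc ∑ b, α v b * C (q v b) ≤ ∑ b, α v b * C 1 := Finset.sum_le_sum fun b _ =>
            mul_le_mul_of_nonneg_left (hCpos _ ((hfeas v hv).2.2 b)).2 ((hfeas v hv).1 b)
        _ = C 1 := by rw [← Finset.sum_mul, (hfeas v hv).2.1, one_mul]
    have h3 := abs_le.1 (hK v hv)
    exact abs_le.2 ⟨by simp only [hpay]; linarith, by simp only [hpay]; linarith⟩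
  have hpayint : ∀ x ∈ X, Integrable (fun τ => pay (x • τ)) (κ x) := fun x hx =>
    Integrable.of_bound (C := C 1 + K) (hpaym.comp (hsm x)).aestronglyMeasurable
      (hx.2.mono fun τ hτ => hpayb _ hτ.1)
  have hcost : ∀ v ∈ S, C (∑ b, w v b) ≤ ∑ b, α v b * C (q v b) := fun v hv => by
    have := hCv.map_sum_le (t := Finset.univ) (w := α v) (p := q v)
      (fun b _ => (hfeas v hv).1 b) (hfeas v hv).2.1 (fun b _ => (hfeas v hv).2.2 b)
    simpa only [smul_eq_mul] using this
  have hjoint : Integrable (fun z : ℝ × (Finset (Fin G) → ℝ) => pay (z.1 • z.2)) (F ⊗ₘ κ) := by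
    refine Integrable.of_bound (C := C 1 + K)
      (hpaym.comp (measurable_fst.smul measurable_snd)).aestronglyMeasurable ?_
    rw [← hcomp, hρ, ae_map_iff hφm.aemeasurable]
    · filter_upwards [hγ] with v hv
      rw [hscale v hv]
      exact hpayb v hv
    · exact measurableSet_le (hpaym.comp (measurable_fst.smul measurable_snd)).norm
        measurable_const
  refine ⟨X, fun x => ∫ τ, r x τ ∂κ x, fun x => ∫ τ, U (x • τ) ∂κ x,
    fun x => ∫ τ, pay (x • τ) ∂κ x, hX, ?_, ?_, ?_, ?_,
    Integrable.integral_compProd (κ := Kernel.const Unit F) (η := Kernel.prodMkLeft Unit κ)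
      (a := ()) hjoint, ?_, ?_⟩
  · filter_upwards [ae_mem_MSupport F, hae] with x h1 h2 using ⟨h1, h2⟩
  · intro x hx
    refine ⟨integral_nonneg_of_ae ((hr01 x hx).mono fun τ h => h.1), ?_⟩
    calc ∫ τ, r x τ ∂κ x ≤ ∫ _, (1 : ℝ) ∂κ x :=
          integral_mono_ae (hrint x hx) (integrable_const _) ((hr01 x hx).mono fun τ h => h.2)
      _ = 1 := by simp
  · intro x hx
    refine integral_nonneg_of_ae (hx.2.mono fun τ h => ?_)
    change 0 ≤ U (x • τ)
    rw [hUeq _ h.1]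
    exact hIR _ h.1
  · intro x hx y hy hxy
    have hy0 := (hX y hy).1.le
    set cl : (Finset (Fin G) → ℝ) → Finset (Fin G) → ℝ := fun τ b => max 0 (min (τ b) 1) with hcl
    have hclm : Measurable cl := by fun_prop
    have hclmono : Monotone cl := fun τ τ' h b => max_le_max le_rfl (min_le_min (h b) le_rfl)
    have hcleq : ∀ z ∈ X, (fun τ => U (y • cl τ)) =ᵐ[κ z] fun τ => U (y • τ) := fun z hz => by
      filter_upwards [hz.2] with τ ⟨h1, h2⟩
      congr 2
      ext b
      have := hτ01 z hz τ h1 h2 b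
      simp [hcl, this.1, this.2]
    have h1 := hdom x hx.1 y hy.1 hxy (fun τ => U (y • cl τ))
      (hUmeas.comp ((hsm y).comp hclm)) (fun τ τ' h => hsm_mono y hy0 _ _ (hclmono h))
      ⟨max |U (y • 0)| |U (y • 1)|, fun τ => abs_le_max_abs_abs
        (hsm_mono y hy0 _ _ fun b => le_max_left _ _)
        (hsm_mono y hy0 _ _ fun b => max_le zero_le_one (min_le_right _ _))⟩
    rw [integral_congr_ae (hcleq x hx), integral_congr_ae (hcleq y hy)] at h1
    refine le_trans ?_ h1
    beta_reduce
    rw [← integral_mul_const, ← integral_add (hUint x hx x (hX x hx).1.le)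
      ((hrint x hx).mul_const _)]
    refine integral_mono_ae ((hUint x hx x (hX x hx).1.le).add ((hrint x hx).mul_const _))
      (hUint x hx y hy0) ?_
    filter_upwards [hx.2] with τ ⟨h2, h3⟩
    refine le_trans (le_of_eq ?_) (hUle _ h2 (y • τ))
    rw [hUeq _ h2]
    have e : ∀ z : ℝ, ∑ b, w (x • τ) b * (z • τ : Finset (Fin G) → ℝ) b = z * r x τ := fun z => by
      simp only [hr, Finset.mul_sum, Pi.smul_apply, smul_eq_mul]
      exact Finset.sum_congr rfl fun b _ => by ring
    rw [e, e]
    ring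
  · intro x hx
    have hx0 := (hX x hx).1.le
    have hCrint : Integrable (fun τ => C (r x τ)) (κ x) := by
      refine Integrable.of_mem_Icc 0 (C 1) (hCc.measurable.comp (hrm x)).aemeasurable ?_
      filter_upwards [hr01 x hx] with τ hτ using hCpos _ hτ
    have hjensen : C (∫ τ, r x τ ∂κ x) ≤ ∫ τ, C (r x τ) ∂κ x :=
      hCv.map_integral_le hCc.continuousOn isClosed_Icc (hr01 x hx) (hrint x hx) hCrint
    have hle : ∫ τ, pay (x • τ) ∂κ x ≤ ∫ τ, (x * r x τ - C (r x τ) - U (x • τ)) ∂κ x := by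
      refine integral_mono_ae (hpayint x hx)
        ((((hrint x hx).const_mul x).sub hCrint).sub (hUint x hx x hx0)) ?_
      filter_upwards [hx.2, hr01 x hx] with τ ⟨h1, h2⟩ h3
      have h4 : r x τ ≤ ∑ b, w (x • τ) b := Finset.sum_le_sum fun b _ =>
        mul_le_of_le_one_right (hw0 _ h1 b) (hτ01 x hx τ h1 h2 b).2
      have h5 := hCm h3 ⟨h3.1.trans h4, hw1 _ h1⟩ h4
      have h6 := hcost _ h1
      have h7 := hUeq _ h1
      have e : ∑ b, w (x • τ) b * (x • τ : Finset (Fin G) → ℝ) b = x * r x τ := by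
        simp only [hr, Finset.mul_sum, Pi.smul_apply, smul_eq_mul]
        exact Finset.sum_congr rfl fun b _ => by ring
      rw [e] at h7
      simp only [hpay]
      linarith
    have hsplit : ∫ τ, (x * r x τ - C (r x τ) - U (x • τ)) ∂κ x
        = x * ∫ τ, r x τ ∂κ x - ∫ τ, C (r x τ) ∂κ x - ∫ τ, U (x • τ) ∂κ x := by
      rw [← integral_const_mul, ← integral_sub ((hrint x hx).const_mul x) hCrint]
      exact integral_sub (((hrint x hx).const_mul x).sub hCrint) (hUint x hx x hx0)
    beta_reduce
    linarith
  · have hjm : Measurable fun z : ℝ × (Finset (Fin G) → ℝ) => pay (z.1 • z.2) :=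
      hpaym.comp (measurable_fst.smul measurable_snd)
    rw [← Measure.integral_compProd hjoint, ← hcomp, hρ,
      integral_map hφm.aemeasurable hjm.aestronglyMeasurable]
    refine integral_congr_ae (hγ.mono fun v hv => ?_)
    beta_reduce
    rw [hscale v hv]

/-- **Proposition 4 (bundling and quality discrimination).** If the vector of value
ratios `τ = (v^b / v^{b*})_b` is stochastically nondecreasing in the grand-bundle
value `v^{b*}`, then an optimal mechanism exists and can be implemented by a menu of
prices for different qualities of the grand bundle. -/
theorem stmt16
    (S : Set (Finset (Fin G) → ℝ)) (hS : IsCompact S)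
    (hSval : ∀ v ∈ S, v ∅ = 0 ∧ (∀ b b' : Finset (Fin G), b ⊆ b' → v b ≤ v b') ∧
      0 < v Finset.univ)
    (γ : Measure (Finset (Fin G) → ℝ)) (hγp : IsProbabilityMeasure γ)
    (hγsupp : γ Sᶜ = 0)
    (C : ℝ → ℝ) (hCc : ContinuousOn C (Icc 0 1)) (hCmono : MonotoneOn C (Icc 0 1))
    (hCconv : ConvexOn ℝ (Icc 0 1) C) (hC0 : C 0 = 0)
    -- τ is stochastically nondecreasing in v^{b*}
    (hτ : ∃ κ : Kernel ℝ (Finset (Fin G) → ℝ),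
      IsRCD (Measure.map
        (fun v : Finset (Fin G) → ℝ =>
          (v Finset.univ, fun b => v b / v Finset.univ)) γ) κ ∧
      ∀ a ∈ MSupport (Measure.map
          (fun v : Finset (Fin G) → ℝ => v Finset.univ) γ),
        ∀ a' ∈ MSupport (Measure.map
          (fun v : Finset (Fin G) → ℝ => v Finset.univ) γ), a < a' →
        ∀ f : (Finset (Fin G) → ℝ) → ℝ, Measurable f → Monotone f →
          (∃ M, ∀ w, |f w| ≤ M) →
          ∫ w, f w ∂(κ a) ≤ ∫ w, f w ∂(κ a')) :
    ∃ α q t, MechanismB S γ α q t ∧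
      -- only the grand bundle is sold, …
      (∀ v, α v Finset.univ = 1 ∧ ∀ b : Finset (Fin G), b ≠ Finset.univ →
        α v b = 0 ∧ q v b = 0) ∧
      -- … and the mechanism is optimal
      (∀ α' q' t', MechanismB S γ α' q' t' →
        MonopolyPayoff C γ α' q' t' ≤ MonopolyPayoff C γ α q t) := by
  obtain ⟨κ, hκ, hdom⟩ := hτ
  have hγ : ∀ᵐ v ∂γ, v ∈ S := hγsupp
  obtain ⟨v₀, hv₀⟩ := hγ.exists
  obtain ⟨M, hM⟩ := (hS.image (continuous_apply Finset.univ)).bddAbove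
  replace hM : ∀ v ∈ S, v Finset.univ ≤ M := fun v hv => hM ⟨v, hv, rfl⟩
  have hM0 : 0 ≤ M := (hSval v₀ hv₀).2.2.le.trans (hM v₀ hv₀)
  set F := γ.map fun v : Finset (Fin G) → ℝ => v Finset.univ with hF
  have hum : Measurable fun v : Finset (Fin G) → ℝ => v Finset.univ := measurable_pi_apply _
  have hF1 : IsProbabilityMeasure F := Measure.isProbabilityMeasure_map hum.aemeasurable
  have hFM : ∀ᵐ x ∂F, x ≤ M := by
    rw [hF, ae_map_iff hum.aemeasurable measurableSet_Iic]
    exact hγ.mono hM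
  set D : ℝ → ℝ := IccExtend zero_le_one ((Icc 0 1).domRestrict C) with hD
  have hDC : EqOn D C (Icc 0 1) := fun z hz => IccExtend_of_mem _ _ hz
  have hDc : Continuous D := hCc.domRestrict.Icc_extend'
  have hDm : MonotoneOn D (Icc 0 1) := hCmono.congr hDC.symm
  have hDv : ConvexOn ℝ (Icc 0 1) D := hCconv.congr hDC.symm
  have hD0 : D 0 = 0 := by rw [hDC (left_mem_Icc.2 zero_le_one), hC0]
  have hpay : ∀ α q t, MechanismB S γ α q t →
      MonopolyPayoff C γ α q t = MonopolyPayoff D γ α q t := fun α q t h =>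
    integral_congr_ae (hγ.mono fun v hv => by
      have : ∀ b, D (q v b) = C (q v b) := fun b => hDC ((h.2.2.2.2.1 v hv).2.2 b)
      simp only [this])
  obtain ⟨p, hpm, hpI, hopt⟩ := exists_monotone_optimal_price F hM0 hFM
  set P : ℝ → ℝ := fun s => p (derivWithin D (Ioi s) s) with hP
  have hPm : Measurable P := hpm.measurable.comp (measurable_derivWithin_Ioi D)
  have hPmono : MonotoneOn P (Ioo 0 1) := fun s hs s' hs' h => hpm <| by
    have := hDv.monotoneOn_rightDeriv
    rw [interior_Icc] at this
    exact this hs hs' h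
  obtain ⟨Q, u, hQm, hum', hQ, hu, hIC, hval⟩ := exists_menu_of_prices F hDc.continuousOn hDm hDv
    hD0 hPm hPmono (fun s => hpI _)
  have hmech : MechanismB S γ (fun _ b => if b = Finset.univ then 1 else 0)
      (fun v b => if b = Finset.univ then Q (v Finset.univ) else 0)
      (fun v => v Finset.univ * Q (v Finset.univ) - u (v Finset.univ)) := by
    have htm : Measurable fun v : Finset (Fin G) → ℝ =>
        v Finset.univ * Q (v Finset.univ) - u (v Finset.univ) :=
      (hum.mul (hQm.measurable.comp hum)).sub (hum'.measurable.comp hum)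
    refine ⟨measurable_const, ?_, htm, ?_, ?_, ?_, ?_⟩
    · refine measurable_pi_lambda _ fun b => ?_
      by_cases hb : b = Finset.univ
      · simp only [hb, if_true]
        exact hQm.measurable.comp hum
      · simp only [hb, if_false, measurable_const]
    · refine Integrable.of_mem_Icc (-u M) M htm.aemeasurable (hγ.mono fun v hv => ?_)
      have h1 := (hSval v hv).2.2.le
      have h2 := hQ (v Finset.univ)
      have h3 := mul_nonneg h1 h2.1
      have h4 := mul_le_of_le_one_right h1 h2.2
      exact ⟨by linarith [hum' (hM v hv)], by linarith [hM v hv, hu (v Finset.univ)]⟩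
    · intro v _
      refine ⟨fun b => by beta_reduce; split_ifs <;> norm_num, by simp, fun b => ?_⟩
      beta_reduce
      split_ifs
      · exact hQ _
      · simp
    · intro v _ v' _
      have := hIC (v' Finset.univ) (v Finset.univ)
      simp only [ite_mul, one_mul, zero_mul, Finset.sum_ite_eq', Finset.mem_univ, if_true]
      linarith
    · intro v _
      have := hu (v Finset.univ)
      simp only [ite_mul, one_mul, zero_mul, Finset.sum_ite_eq', Finset.mem_univ, if_true]
      linarith
  refine ⟨_, _, _, hmech, fun v => ⟨if_pos rfl, fun b hb => ⟨if_neg hb, if_neg hb⟩⟩, ?_⟩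
  intro α' q' t' h'
  obtain ⟨X, Q', u', A, hX, hFX, hQ', hu', hIC', hA, hAle, hAval⟩ :=
    exists_averaged_mechanism hS.measurableSet hSval hM hγ hDc hDm hDv hD0 hκ hdom h'
  have hbest : MonopolyPayoff D γ (fun _ b => if b = Finset.univ then 1 else 0)
      (fun v b => if b = Finset.univ then Q (v Finset.univ) else 0)
      (fun v => v Finset.univ * Q (v Finset.univ) - u (v Finset.univ))
      = ∫ x, (-D (Q x) + (x * Q x - u x)) ∂F := by
    have hgm : Measurable fun x => -D (Q x) + (x * Q x - u x) :=
      (hDc.measurable.comp hQm.measurable).neg.add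
        ((measurable_id.mul hQm.measurable).sub hum'.measurable)
    rw [hF, integral_map hum.aemeasurable hgm.aestronglyMeasurable]
    simp [MonopolyPayoff]
  rw [hpay _ _ _ hmech, hpay _ _ _ h', hAval, hbest, hval]
  exact integral_payoff_le_of_downward_IC F hDc.continuousOn hDm hDv hD0 hPm (fun s => hpI _)
    (fun s => hopt _) hX hFX hQ' hu' hIC' hA hAle
end
end
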